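/- arXiv:1208.2579 — 2 statements merged into one kernel-verified Lean document; each statement's English description precedes it below -/
import Mathlib

section
/- Assume κ > ℵ₀ is a measurable cardinal and κ < λ. Then there is an ultrafilter D on λ such that: (1) D is λ-regular; (2) D is λ-flexible; and (3) D is not κ⁺⁺-good. -/
open Cardinal Set

universe u

/-- `A = ∅ mod D`: the complement of `A` belongs to the filter `D`. -/
def ZeroMod {I : Type u} (D : Filter I) (A : Set I) : Prop := Aᶜ ∈ D

/-- `A ≠ ∅ mod D`: the complement of `A` does not belong to the filter `D`. -/
def NonzeroMod {I : Type u} (D : Filter I) (A : Set I) : Prop := Aᶜ ∉ D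

/-- `A ⊆ B mod D`. -/
def SubsetMod {I : Type u} (D : Filter I) (A B : Set I) : Prop := ZeroMod D (A \ B)

/-- `A = B mod D`. -/
def EqMod {I : Type u} (D : Filter I) (A B : Set I) : Prop := SubsetMod D A B ∧ SubsetMod D B A

/-- `D` is a `lam`-regular filter on `I`: there is a family `⟨X i : i < lam⟩` of members of `D`
such that every `t ∈ I` belongs to only finitely many of the `X i`. -/
def IsRegularFilter {I : Type u} (lam : Cardinal.{u}) (D : Filter I) : Prop :=
  ∃ X : Ordinal.{u} → Set I, (∀ i, i < lam.ord → X i ∈ D) ∧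
    ∀ t : I, {i : Ordinal.{u} | i < lam.ord ∧ t ∈ X i}.Finite

/-- `f : I → ℕ` is `D`-nonstandard. -/
def IsNonstandard {I : Type u} (D : Filter I) (f : I → ℕ) : Prop := ∀ n : ℕ, {t | n < f t} ∈ D

/-- `f <_D g`. -/
def ltD {I : Type u} (D : Filter I) (f g : I → ℕ) : Prop := {t | f t < g t} ∈ D

/-- `f ≤_D g`. -/
def leD {I : Type u} (D : Filter I) (f g : I → ℕ) : Prop := {t | f t ≤ g t} ∈ D

/-- Flexibility for a family of sets (e.g. `D.sets`): for every nonstandard `f` there is a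
`theta`-indexed family of members below `f`. -/
def IsFlexibleSets {I : Type u} (theta : Cardinal.{u}) (F : Set (Set I)) : Prop :=
  ∀ f : I → ℕ, (∀ n : ℕ, {t | n < f t} ∈ F) →
    ∃ X : Ordinal.{u} → Set I, (∀ α, α < theta.ord → X α ∈ F) ∧
      ∀ t : I, #{α : Ordinal.{u} // α < theta.ord ∧ t ∈ X α} ≤ (f t : Cardinal)

/-- `D` is a `theta`-flexible filter. -/
def IsFlexible {I : Type u} (theta : Cardinal.{u}) (D : Filter I) : Prop :=
  IsFlexibleSets theta D.sets

/-- `F` (e.g. the sets of a filter) is `mu⁺`-good: every monotonic map from finite subsets of `mu`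
into `F` has a multiplicative refinement. Finite subsets of `mu` are represented as finite sets of
ordinals `< mu.ord`. -/
def IsGoodSets {I : Type u} (mu : Cardinal.{u}) (F : Set (Set I)) : Prop :=
  ∀ f : Finset Ordinal.{u} → Set I,
    (∀ u : Finset Ordinal.{u}, ↑u ⊆ Set.Iio mu.ord → f u ∈ F) →
    (∀ u v : Finset Ordinal.{u}, ↑v ⊆ Set.Iio mu.ord → u ⊆ v → f v ⊆ f u) →
    ∃ f' : Finset Ordinal.{u} → Set I,
      (∀ u, ↑u ⊆ Set.Iio mu.ord → f' u ∈ F) ∧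
      (∀ u, ↑u ⊆ Set.Iio mu.ord → f' u ⊆ f u) ∧
      ∀ u v, ↑u ⊆ Set.Iio mu.ord → ↑v ⊆ Set.Iio mu.ord → f' u ∩ f' v = f' (u ∪ v)

/-- The filter `D` is `mu⁺`-good. -/
def IsGoodFilter {I : Type u} (mu : Cardinal.{u}) (D : Filter I) : Prop := IsGoodSets mu D.sets

/-- An element of `FIN(G)`: a function whose domain is a finite subset of `G`, with
`h(g) ∈ range(g)` for each `g` in the domain. Functions in `G` take ordinal values. -/
structure PartialAssignment (I : Type u) (G : Set (I → Ordinal.{u})) where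
  dom : Finset (I → Ordinal.{u})
  dom_sub : ↑dom ⊆ G
  val : (I → Ordinal.{u}) → Ordinal.{u}
  val_mem : ∀ g ∈ dom, val g ∈ Set.range g

/-- The set `A_h = {t ∈ I : g(t) = h(g) for all g ∈ dom h}`. -/
def PartialAssignment.Aset {I : Type u} {G : Set (I → Ordinal.{u})}
    (h : PartialAssignment I G) : Set I :=
  {t | ∀ g ∈ h.dom, g t = h.val g}

/-- `G` is independent mod `D`: `A_h ≠ ∅ mod D` for every `h ∈ FIN(G)`. -/
def IndependentMod {I : Type u} (D : Filter I) (G : Set (I → Ordinal.{u})) : Prop :=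
  ∀ h : PartialAssignment I G, NonzeroMod D h.Aset

/-- `(I, D, G)` is a `(lam, mu)`-pre-good triple: `|I| = lam`, `D` is a `lam`-regular filter,
`G` is a family of functions from `I` to `mu` (ordinals `< mu.ord`), independent mod `D`. -/
def IsPreGoodTriple {I : Type u} (lam mu : Cardinal.{u}) (D : Filter I)
    (G : Set (I → Ordinal.{u})) : Prop :=
  #I = lam ∧ IsRegularFilter lam D ∧ (∀ g ∈ G, ∀ t : I, g t < mu.ord) ∧ IndependentMod D G

/-- `(I, D, G)` is a `(lam, mu)`-good triple: pre-good and `D` maximal among filters modulo which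
`G` is independent. -/
def IsGoodTriple {I : Type u} (lam mu : Cardinal.{u}) (D : Filter I)
    (G : Set (I → Ordinal.{u})) : Prop :=
  IsPreGoodTriple lam mu D G ∧
    ∀ D' : Filter I, (∀ A ∈ D, A ∈ D') → IndependentMod D' G → D' = D

/-- `A` is supported by `G` mod `D`: there is a partition of `I` into sets of the form `A_h`,
`h ∈ FIN(G)`, each of which is `⊆ A mod D` or disjoint from `A mod D`. -/
def SupportedBy {I : Type u} (D : Filter I) (G : Set (I → Ordinal.{u})) (A : Set I) : Prop :=
  ∃ P : Set (Set I),
    (∀ X ∈ P, ∃ h : PartialAssignment I G, X = h.Aset) ∧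
    (∀ X ∈ P, ∀ Y ∈ P, X ≠ Y → X ∩ Y = ∅) ∧
    ⋃₀ P = Set.univ ∧
    ∀ X ∈ P, SubsetMod D X A ∨ ZeroMod D (X ∩ A)

/-- `R` is the edge relation of a model of the random graph with vertex set `mu`
(identified with the ordinals `< mu.ord`). -/
def IsRandomGraphOn (mu : Cardinal.{u}) (R : Ordinal.{u} → Ordinal.{u} → Prop) : Prop :=
  (∀ a b, a < mu.ord → b < mu.ord → (R a b ↔ R b a)) ∧
  (∀ a, a < mu.ord → ¬ R a a) ∧
  ∀ U V : Finset Ordinal.{u}, ↑U ⊆ Set.Iio mu.ord → ↑V ⊆ Set.Iio mu.ord → Disjoint U V →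
    ∃ x, x < mu.ord ∧ (∀ a ∈ U, R x a) ∧ ∀ b ∈ V, ¬ R x b

/-- An ordinal `γ = β + n` (`β` limit or zero, `n < ω`) is even iff `n` is even,
equivalently iff `γ = 2·δ` for some ordinal `δ`. -/
def EvenOrdinal (γ : Ordinal.{u}) : Prop := ∃ δ : Ordinal.{u}, γ = 2 * δ

/-- `lcf(ℵ₀, D)`: the least cardinality of a family `S` of `D`-nonstandard functions
such that every `D`-nonstandard `g` satisfies `f ≤_D g` for some `f ∈ S`. -/
noncomputable def lcfAleph0 {I : Type u} (D : Filter I) : Cardinal.{u} :=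
  sInf { c : Cardinal.{u} | ∃ S : Set (I → ℕ), #S = c ∧ (∀ f ∈ S, IsNonstandard D f) ∧
    ∀ g : I → ℕ, IsNonstandard D g → ∃ f ∈ S, leD D f g }

/-- A filter on a Boolean algebra. -/
def IsBAFilter {B : Type u} [BooleanAlgebra B] (E : Set B) : Prop :=
  ⊤ ∈ E ∧ (∀ a b : B, a ∈ E → a ≤ b → b ∈ E) ∧ ∀ a b : B, a ∈ E → b ∈ E → a ⊓ b ∈ E

/-- An ultrafilter on a Boolean algebra: a maximal proper filter. -/
def IsBAUltrafilter {B : Type u} [BooleanAlgebra B] (E : Set B) : Prop :=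
  IsBAFilter E ∧ ⊥ ∉ E ∧ ∀ E' : Set B, IsBAFilter E' → ⊥ ∉ E' → E ⊆ E' → E' = E

/-- `E` is a `theta`-complete subset of the complete Boolean algebra `B`: every subset of `E`
of cardinality `< theta` has its infimum in `E`. -/
def IsThetaComplete {B : Type u} [CompleteBooleanAlgebra B] (theta : Cardinal.{u})
    (E : Set B) : Prop :=
  ∀ S : Set B, S ⊆ E → #S < theta → sInf S ∈ E

/-- `X ⊆ B` is `rho⁺`-good: every monotonic `fss(rho)`-indexed sequence of members of `X`
has a multiplicative refinement in `X`. -/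
def IsGoodBA {B : Type u} [BooleanAlgebra B] (rho : Cardinal.{u}) (X : Set B) : Prop :=
  ∀ a : Finset Ordinal.{u} → B,
    (∀ u, ↑u ⊆ Set.Iio rho.ord → a u ∈ X) →
    (∀ u v, ↑v ⊆ Set.Iio rho.ord → u ⊆ v → a v ≤ a u) →
    ∃ b : Ordinal.{u} → B, (∀ α, α < rho.ord → b α ∈ X) ∧
      ∀ u : Finset Ordinal.{u}, ↑u ⊆ Set.Iio rho.ord → u.inf b ≤ a u

/-- `kappa` is a measurable cardinal: uncountable, carrying a nonprincipal `kappa`-complete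
ultrafilter. -/
def IsMeasurableCard (kappa : Cardinal.{u}) : Prop :=
  ℵ₀ < kappa ∧ ∃ (K : Type u) (U : Ultrafilter K), #K = kappa ∧
    (∀ a : K, ({a} : Set K) ∉ U) ∧
    ∀ S : Set (Set K), (∀ A ∈ S, A ∈ U) → #S < kappa → ⋂₀ S ∈ U

/-- `kappa` is weakly compact: uncountable and every 2-coloring of pairs of ordinals `< kappa.ord`
has a homogeneous set of cardinality `kappa`. -/
def IsWeaklyCompactCard (kappa : Cardinal.{u}) : Prop :=
  ℵ₀ < kappa ∧ ∀ c : Ordinal.{u} → Ordinal.{u} → Bool,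
    ∃ U : Set Ordinal.{u}, U ⊆ Set.Iio kappa.ord ∧ #U = Cardinal.lift.{u+1} kappa ∧
      ∃ v : Bool, ∀ ε ∈ U, ∀ ζ ∈ U, ε < ζ → c ε ζ = v

namespace FlexibleUltrafilter

/-- The underlying set of the Engelking–Karłowicz family over `L`. -/
abbrev Point (L : Type u) : Type u := Finset L × Finset (Finset L × L)

open Classical in
/-- The finite-set valued function on `Point L` attached to a subset `A` of `L`; these functions
form an independent family. -/
noncomputable def sectionAt {L : Type u} (A : Set L) (p : Point L) : Finset L :=
  (p.2.filter (fun q => q.1 = p.1.filter (· ∈ A))).image Prod.snd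

/-- The functions `sectionAt A`, for `A ∉ R`, are independent modulo `D`. -/
def IndependentOff {L : Type u} (D : Filter (Point L)) (R : Set (Set L)) : Prop :=
  ∀ (H : Finset (Set L)) (v : Set L → Finset L), (∀ A ∈ H, A ∉ R) →
    ∃ᶠ p in D, ∀ A ∈ H, sectionAt A p = v A

/-- Either `f` is bounded modulo `D`, or it bounds the sizes of finite sets covering `L`. -/
def Resolves {L : Type u} (D : Filter (Point L)) (f : Point L → ℕ) : Prop :=
  (∃ n, ∀ᶠ p in D, f p ≤ n) ∨
    ∃ s : Point L → Finset L, (∀ p, (s p).card ≤ f p) ∧ ∀ l, ∀ᶠ p in D, l ∈ s p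

/-- The regular filter generated by the sets `{p | l ∈ p.1}`. -/
def coverFilter (L : Type u) : Filter (Point L) := Filter.comap Prod.fst Filter.atTop

variable {L : Type u}

lemma Resolves.mono {D D' : Filter (Point L)} {f : Point L → ℕ} (h : Resolves D f)
    (hD : D' ≤ D) : Resolves D' f := by
  rcases h with ⟨n, hn⟩ | ⟨s, hs, hl⟩
  · exact Or.inl ⟨n, hD hn⟩
  · exact Or.inr ⟨s, hs, fun l => hD (hl l)⟩

lemma exists_finset_separating (H : Finset (Set L)) :
    ∃ F : Finset L, ∀ A ∈ H, ∀ B ∈ H, (∀ l ∈ F, l ∈ A ↔ l ∈ B) → A = B := by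
  classical
  by_cases hL : Nonempty L
  · have hd : ∀ q : Set L × Set L, ∃ l, (l ∈ q.1 ↔ l ∈ q.2) → q.1 = q.2 := by
      intro q
      by_contra! hq
      obtain ⟨l⟩ := hL
      exact (hq l).2 (Set.ext fun x => (hq x).1)
    choose d hd using hd
    refine ⟨(H ×ˢ H).image d, fun A hA B hB h => hd (A, B) (h _ ?_)⟩
    exact Finset.mem_image_of_mem _ (Finset.mk_mem_product hA hB)
  · exact ⟨∅, fun A _ B _ _ => Set.ext fun x => (hL ⟨x⟩).elim⟩

lemma independentOff_coverFilter : IndependentOff (coverFilter L) ∅ := by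
  classical
  intro H v _
  rw [coverFilter, Filter.frequently_comap, Filter.frequently_atTop]
  intro u
  obtain ⟨F, hF⟩ := exists_finset_separating H
  refine ⟨u ∪ F, Finset.subset_union_left,
    (u ∪ F, H.biUnion fun A => (v A).image fun l => ((u ∪ F).filter (· ∈ A), l)), rfl, ?_⟩
  intro A hA
  ext l
  simp only [sectionAt, Finset.mem_image, Finset.mem_filter, Finset.mem_biUnion, Prod.exists,
    Prod.mk.injEq, exists_eq_right]
  constructor
  · rintro ⟨B, hB, l', hl', hw, rfl⟩
    have : B = A := hF B hB A hA fun x hx => by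
      have := congrArg (x ∈ ·) hw
      simpa [hx] using this
    exact this ▸ hl'
  · intro hl
    exact ⟨A, hA, l, hl, rfl, rfl⟩

lemma IndependentOff.exists_step {D : Filter (Point L)} {R : Set (Set L)}
    (hD : IndependentOff D R) (hR : R ≠ Set.univ) (f : Point L → ℕ) :
    ∃ (D' : Filter (Point L)) (R' : Set (Set L)), D' ≤ D ∧ R ⊆ R' ∧ (R' \ R).Finite ∧
      IndependentOff D' R' ∧ Resolves D' f := by
  classical
  by_cases hT : IndependentOff (D ⊓ Filter.comap f Filter.atTop) R
  · obtain ⟨A, hA⟩ := (Set.ne_univ_iff_exists_notMem R).1 hR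
    let s : Point L → Finset L := fun p =>
      if (sectionAt A p).card ≤ f p then sectionAt A p else ∅
    refine ⟨D ⊓ Filter.comap f Filter.atTop ⊓ Filter.comap s Filter.atTop, insert A R,
      inf_le_left.trans inf_le_left, Set.subset_insert _ _,
      (Set.finite_singleton A).subset ?_, ?_, Or.inr ⟨s, ?_, ?_⟩⟩
    · rintro B ⟨rfl | hB, hB'⟩
      · rfl
      · exact (hB' hB).elim
    · intro H v hH hcon
      obtain ⟨a, ha, b, hb, hab⟩ := Filter.eventually_inf.1 hcon
      obtain ⟨u, hu⟩ := Filter.eventually_atTop.1 (Filter.eventually_comap.1 hb)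
      have hf : ∀ᶠ p in D ⊓ Filter.comap f Filter.atTop, u.card ≤ f p :=
        (Filter.tendsto_comap.eventually (Filter.eventually_ge_atTop u.card)).filter_mono
          inf_le_right
      have hind := hT (insert A H) (Function.update v A u) (by
        intro B hB
        rcases Finset.mem_insert.1 hB with rfl | hB
        · exact hA
        · exact fun h => hH B hB (Set.mem_insert_of_mem _ h))
      obtain ⟨p, hp, hpf, hpa⟩ := (hind.and_eventually (hf.and ha)).exists
      have hpA : sectionAt A p = u := by simpa using hp A (Finset.mem_insert_self _ _)
      have hs : s p = u := by simp [s, hpA, hpf]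
      refine hab p ⟨hpa, hu u le_rfl p hs⟩ fun B hB => ?_
      have hBA : B ≠ A := fun h => hH B hB (h ▸ Set.mem_insert _ _)
      simpa [hBA] using hp B (Finset.mem_insert_of_mem hB)
    · intro p
      by_cases h : (sectionAt A p).card ≤ f p <;> simp [s, h]
    · intro l
      refine Filter.Eventually.filter_mono inf_le_right ?_
      filter_upwards [Filter.tendsto_comap.eventually (Filter.eventually_ge_atTop {l})] with p hp
      exact hp (Finset.mem_singleton_self l)
  · unfold IndependentOff at hT
    simp only [not_forall, exists_prop, Filter.not_frequently] at hT
    obtain ⟨H, v, hH, hcon⟩ := hT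
    obtain ⟨a, ha, b, hb, hab⟩ := Filter.eventually_inf.1 hcon
    obtain ⟨n, hn⟩ := Filter.eventually_atTop.1 (Filter.eventually_comap.1 hb)
    refine ⟨D ⊓ Filter.principal {p | ∀ A ∈ H, sectionAt A p = v A}, R ∪ H, inf_le_left,
      Set.subset_union_left, H.finite_toSet.subset ?_, ?_, Or.inl ⟨n, ?_⟩⟩
    · rintro B ⟨hB | hB, hB'⟩
      · exact (hB' hB).elim
      · exact hB
    · intro H' v' hH'
      rw [Filter.frequently_inf_principal]
      refine (hD (H ∪ H') (fun B => if B ∈ H then v B else v' B) ?_).mono fun p hp => ⟨?_, ?_⟩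
      · intro B hB
        rcases Finset.mem_union.1 hB with hB | hB
        · exact hH B hB
        · exact fun h => hH' B hB (Or.inl h)
      · intro B hB
        simpa [hB] using hp B (Finset.mem_union_left _ hB)
      · intro B hB
        have hBH : B ∉ H := fun h => hH' B hB (Or.inr h)
        simpa [hBH] using hp B (Finset.mem_union_right _ hB)
    · rw [Filter.eventually_inf_principal]
      filter_upwards [ha] with p hp hpH
      by_contra! hlt
      obtain ⟨A, hA, hne⟩ := hab p ⟨hp, hn _ hlt.le p rfl⟩
      exact hne (hpH A hA)

lemma IndependentOff.sInf_of_directedOn {S : Set (Filter (Point L))} {R : Set (Set L)} (hne : S.Nonempty)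
    (hS : DirectedOn (· ≥ ·) S) (h : ∀ D ∈ S, IndependentOff D R) :
    IndependentOff (sInf S) R := by
  intro H v hH hcon
  rw [sInf_eq_iInf] at hcon
  obtain ⟨D, hD, hcon⟩ := (Filter.mem_biInf_of_directed (f := id) hS hne).1 hcon
  exact h D hD H v hH hcon

section Recursion

variable {J : Type u} [LinearOrder J] [WellFoundedLT J]

open Classical in
/-- One step of the construction, resolving `f`. -/
noncomputable def step (f : Point L → ℕ) (x : Filter (Point L) × Set (Set L)) :
    Filter (Point L) × Set (Set L) :=
  if h : ∃ y : Filter (Point L) × Set (Set L), y.1 ≤ x.1 ∧ x.2 ⊆ y.2 ∧ (y.2 \ x.2).Finite ∧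
      IndependentOff y.1 y.2 ∧ Resolves y.1 f
  then h.choose else x

lemma step_le (f : Point L → ℕ) (x : Filter (Point L) × Set (Set L)) :
    (step f x).1 ≤ x.1 ∧ x.2 ⊆ (step f x).2 ∧ ((step f x).2 \ x.2).Finite := by
  unfold step
  split_ifs with h
  · exact ⟨h.choose_spec.1, h.choose_spec.2.1, h.choose_spec.2.2.1⟩
  · simp

lemma step_spec (f : Point L → ℕ) {x : Filter (Point L) × Set (Set L)}
    (hx : IndependentOff x.1 x.2) (hR : x.2 ≠ Set.univ) :
    IndependentOff (step f x).1 (step f x).2 ∧ Resolves (step f x).1 f := by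
  have h : ∃ y : Filter (Point L) × Set (Set L), y.1 ≤ x.1 ∧ x.2 ⊆ y.2 ∧ (y.2 \ x.2).Finite ∧
      IndependentOff y.1 y.2 ∧ Resolves y.1 f := by
    obtain ⟨D', R', h⟩ := hx.exists_step hR f
    exact ⟨(D', R'), h⟩
  unfold step
  rw [dif_pos h]
  exact h.choose_spec.2.2.2

/-- The sequence of filters and removed index sets, resolving `F j` at stage `j`. -/
noncomputable def stage (F : J → Point L → ℕ) : J → Filter (Point L) × Set (Set L) :=
  wellFounded_lt.fix fun j ih =>
    step (F j) (sInf (insert (coverFilter L) {D | ∃ i, ∃ h : i < j, D = (ih i h).1}),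
      {A | ∃ i, ∃ h : i < j, A ∈ (ih i h).2})

/-- The limit of the stages before `j`. -/
noncomputable def stageBelow (F : J → Point L → ℕ) (j : J) : Filter (Point L) × Set (Set L) :=
  (sInf (insert (coverFilter L) {D | ∃ i, ∃ _ : i < j, D = (stage F i).1}),
    {A | ∃ i, ∃ _ : i < j, A ∈ (stage F i).2})

lemma stage_eq (F : J → Point L → ℕ) (j : J) : stage F j = step (F j) (stageBelow F j) :=
  wellFounded_lt.fix_eq _ j

lemma stage_fst_le (F : J → Point L → ℕ) (j : J) : (stage F j).1 ≤ (stageBelow F j).1 :=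
  stage_eq F j ▸ (step_le _ _).1

lemma stage_fst_le_coverFilter (F : J → Point L → ℕ) (j : J) :
    (stage F j).1 ≤ coverFilter L :=
  (stage_fst_le F j).trans (sInf_le (Set.mem_insert _ _))

lemma stage_fst_antitone (F : J → Point L → ℕ) {i j : J} (h : i ≤ j) :
    (stage F j).1 ≤ (stage F i).1 := by
  rcases h.eq_or_lt with rfl | h
  · rfl
  · exact (stage_fst_le F j).trans (sInf_le (Set.mem_insert_of_mem _ ⟨i, h, rfl⟩))

lemma stage_snd_subset (F : J → Point L → ℕ) (j : J) :
    (stage F j).2 ⊆ ⋃ i ∈ Set.Iic j, (stage F i).2 \ (stageBelow F i).2 := by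
  induction j using WellFoundedLT.induction with
  | ind j ih =>
    intro A hA
    by_cases h : A ∈ (stageBelow F j).2
    · obtain ⟨i, hij, hAi⟩ := h
      have := ih i hij hAi
      simp only [Set.mem_iUnion] at this ⊢
      obtain ⟨k, hk, hAk⟩ := this
      exact ⟨k, le_trans hk hij.le, hAk⟩
    · simp only [Set.mem_iUnion]
      exact ⟨j, le_refl j, hA, h⟩

lemma mk_stageBelow_snd_lt [Infinite L] (F : J → Point L → ℕ)
    (hJ : ∀ j : J, #(Set.Iio j) < #(Set L)) (j : J) : #(stageBelow F j).2 < #(Set L) := by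
  have hsub : (stageBelow F j).2 ⊆ ⋃ i ∈ Set.Iio j, (stage F i).2 \ (stageBelow F i).2 := by
    rintro A ⟨i, hij, hA⟩
    have := stage_snd_subset F i hA
    simp only [Set.mem_iUnion] at this ⊢
    obtain ⟨k, hk, hAk⟩ := this
    exact ⟨k, lt_of_le_of_lt hk hij, hAk⟩
  refine ((Cardinal.mk_le_mk_of_subset hsub).trans (Cardinal.mk_biUnion_le _ _)).trans_lt ?_
  have hinf : ℵ₀ < #(Set L) := by
    rw [Cardinal.mk_set]
    exact (Cardinal.aleph0_le_mk L).trans_lt (Cardinal.cantor _)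
  refine Cardinal.mul_lt_of_lt hinf.le (hJ j) (lt_of_le_of_lt ?_ hinf)
  refine ciSup_le' fun i => ?_
  have hfin : ((stage F i.1).2 \ (stageBelow F i.1).2).Finite := by
    rw [stage_eq F i.1]
    exact (step_le _ _).2.2
  exact hfin.countable.le_aleph0

lemma directedOn_insert_stage (F : J → Point L → ℕ) (T : Set J) :
    DirectedOn (· ≥ ·) (insert (coverFilter L) {D | ∃ i, ∃ _ : i ∈ T, D = (stage F i).1}) := by
  rintro D (rfl | ⟨i, hi, rfl⟩) E (rfl | ⟨k, hk, rfl⟩)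
  · exact ⟨_, Set.mem_insert _ _, le_rfl, le_rfl⟩
  · exact ⟨_, Or.inr ⟨k, hk, rfl⟩, stage_fst_le_coverFilter F k, le_rfl⟩
  · exact ⟨_, Or.inr ⟨i, hi, rfl⟩, le_rfl, stage_fst_le_coverFilter F i⟩
  · rcases le_total i k with h | h
    · exact ⟨_, Or.inr ⟨k, hk, rfl⟩, stage_fst_antitone F h, le_rfl⟩
    · exact ⟨_, Or.inr ⟨i, hi, rfl⟩, le_rfl, stage_fst_antitone F h⟩

lemma IndependentOff.mono {D : Filter (Point L)} {R R' : Set (Set L)} (h : IndependentOff D R)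
    (hR : R ⊆ R') : IndependentOff D R' :=
  fun H v hH => h H v fun A hA hAR => hH A hA (hR hAR)

lemma stage_spec [Infinite L] (F : J → Point L → ℕ)
    (hJ : ∀ j : J, #(Set.Iio j) < #(Set L)) (j : J) :
    IndependentOff (stage F j).1 (stage F j).2 ∧ Resolves (stage F j).1 (F j) := by
  induction j using WellFoundedLT.induction with
  | ind j ih =>
    rw [stage_eq]
    apply step_spec
    · refine IndependentOff.sInf_of_directedOn (Set.insert_nonempty _ _)
        (directedOn_insert_stage F (Set.Iio j)) ?_
      rintro D (rfl | ⟨i, hi, rfl⟩)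
      · exact independentOff_coverFilter.mono (Set.empty_subset _)
      · exact (ih i hi).1.mono fun A hA => ⟨i, hi, hA⟩
    · intro h
      have := mk_stageBelow_snd_lt F hJ j
      rw [h, Cardinal.mk_univ] at this
      exact this.false

end Recursion

/-- There is a regular ultrafilter on `Point L` which resolves every function to `ℕ`. -/
lemma exists_ultrafilter_resolves (L : Type u) [Infinite L] :
    ∃ D : Ultrafilter (Point L), (D : Filter (Point L)) ≤ coverFilter L ∧
      ∀ f : Point L → ℕ, Resolves (D : Filter (Point L)) f := by
  let J : Type u := (#(Set L)).ord.ToType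
  have hcard : #J = #(Point L → ℕ) := by
    simp [J, Point, Cardinal.mk_set, Cardinal.power_eq_two_power]
  obtain ⟨F⟩ := Cardinal.eq.1 hcard
  have hJ : ∀ j : J, #(Set.Iio j) < #(Set L) := fun j => by
    simpa [J] using Cardinal.mk_Iio_lt j (by simp [J])
  let S := insert (coverFilter L) {D | ∃ i, ∃ _ : i ∈ (Set.univ : Set J), D = (stage F i).1}
  have hind : IndependentOff (sInf S) Set.univ := by
    refine IndependentOff.sInf_of_directedOn (Set.insert_nonempty _ _) (directedOn_insert_stage F _) ?_
    rintro D (rfl | ⟨i, -, rfl⟩)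
    · exact independentOff_coverFilter.mono (Set.empty_subset _)
    · exact (stage_spec F hJ i).1.mono (Set.subset_univ _)
  have hne : (sInf S).NeBot := by
    have := hind ∅ (fun _ => ∅) (by simp)
    exact Filter.neBot_iff.2 fun h => by simp [h] at this
  refine ⟨Ultrafilter.of (sInf S), (Ultrafilter.of_le _).trans (sInf_le (Set.mem_insert _ _)),
    fun f => ?_⟩
  have h := (stage_spec F hJ (F.symm f)).2
  rw [F.apply_symm_apply] at h
  exact h.mono ((Ultrafilter.of_le _).trans
    (sInf_le (Set.mem_insert_of_mem _ ⟨F.symm f, Set.mem_univ _, rfl⟩)))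

lemma lift_self_succ (a : Cardinal.{u + 1}) : Cardinal.lift.{u, u + 1} a = a :=
  Cardinal.lift_id'.{u, u + 1} a

lemma exists_injOn_Iio {K : Type u} [Nonempty K] {o : Ordinal.{u}} (h : o.card ≤ #K) :
    ∃ e : Ordinal.{u} → K, Set.InjOn e (Set.Iio o) := by
  have : Nonempty (Set.Iio o ↪ K) := by
    rw [← Cardinal.lift_mk_le', Cardinal.mk_Iio_ordinal, Cardinal.lift_lift, Cardinal.lift_le]
    exact h
  obtain ⟨g⟩ := this
  refine ⟨Function.extend Subtype.val g fun _ => Classical.arbitrary K, fun a ha b hb hab => ?_⟩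
  have hval := fun x : Set.Iio o => Subtype.val_injective.extend_apply g
    (fun _ => Classical.arbitrary K) x
  rw [hval ⟨a, ha⟩, hval ⟨b, hb⟩] at hab
  exact congrArg Subtype.val (g.injective hab)

/-- A well order all of whose proper initial segments have size `< c` has size `≤ c`. -/
lemma mk_le_of_forall_mk_Iio_lt {B : Type*} [LinearOrder B] [WellFoundedLT B] {c : Cardinal}
    (h : ∀ b : B, #(Set.Iio b) < c) : #B ≤ c := by
  have hle : Ordinal.type (α := B) (· < ·) ≤ c.ord := by
    refine le_of_forall_lt fun o ho => ?_
    obtain ⟨b, rfl⟩ := Ordinal.typein_surj (α := B) (· < ·) ho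
    rw [Cardinal.lt_ord, Ordinal.card_typein]
    exact h b
  simpa using Ordinal.card_le_card hle

lemma exists_pairs_of_complete {K : Type u} (U : Ultrafilter K) [Infinite K]
    (hU : ∀ A : Set K, #A < #K → Aᶜ ∈ U) :
    ∃ c : K → Ordinal.{u} → Ordinal.{u} → Prop,
      (∀ γ β, β < (Order.succ #K).ord → γ < β → ∀ᶠ k in U, c k γ β) ∧
      ∀ (k : K) (B : Set Ordinal.{u}), B ⊆ Set.Iio (Order.succ #K).ord →
        (∀ β ∈ B, ∀ γ ∈ B, γ < β → c k γ β) → #B ≤ Cardinal.lift.{u + 1} #K := by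
  classical
  obtain ⟨hlin, hwf, hK⟩ := Cardinal.exists_ord_eq_type_lt K
  have he : ∀ β : Ordinal.{u}, ∃ e : Ordinal.{u} → K,
      β < (Order.succ #K).ord → Set.InjOn e (Set.Iio β) := by
    intro β
    by_cases hβ : β < (Order.succ #K).ord
    · obtain ⟨e, he⟩ := exists_injOn_Iio (Order.lt_succ_iff.1 (Cardinal.lt_ord.1 hβ))
      exact ⟨e, fun _ => he⟩
    · exact ⟨fun _ => Classical.arbitrary K, fun h => (hβ h).elim⟩
  choose e he using he
  refine ⟨fun k γ β => e β γ ≤ k, fun γ β _ _ => ?_, fun k B hB hc => ?_⟩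
  · have := hU (Set.Iio (e β γ)) (Cardinal.mk_Iio_lt _ hK)
    rwa [Set.compl_Iio] at this
  · refine mk_le_of_forall_mk_Iio_lt fun b => ?_
    let g : Set.Iio b → Set.Iic k := fun x => ⟨e b x, hc b b.2 x x.1.2 x.2⟩
    have hg : Function.Injective g := by
      intro x y hxy
      have := he b (hB b.2) x.2 y.2 (Subtype.ext_iff.1 hxy)
      exact Subtype.ext (Subtype.ext this)
    have hle := Cardinal.lift_mk_le_lift_mk_of_injective hg
    have hlt : #(Set.Iic k) < #K := by
      rw [← Set.Iio_insert]
      refine Cardinal.mk_insert_le.trans_lt (Cardinal.add_lt_of_lt (Cardinal.aleph0_le_mk K)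
        (Cardinal.mk_Iio_lt _ hK) ?_)
      exact Cardinal.one_lt_aleph0.trans_le (Cardinal.aleph0_le_mk K)
    have hlt' := hle.trans_lt (Cardinal.lift_lt.{u, u + 1}.2 hlt)
    rwa [lift_self_succ] at hlt'

/-- The ultrafilter on `I ≃ P × K` which is `D` on almost every fibre modulo `U` is not
`κ⁺⁺`-good, `κ = #K`. -/
lemma not_isGoodFilter_bind {I P K : Type u} (U : Ultrafilter K) [Infinite K]
    (hU : ∀ A : Set K, #A < #K → Aᶜ ∈ U) (D : Ultrafilter P) (e : I ≃ P × K) :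
    ¬ IsGoodFilter (Order.succ #K)
      (U.bind fun k => D.map fun p => e.symm (p, k) : Ultrafilter I).toFilter := by
  classical
  intro hgood
  obtain ⟨c, hc, hB⟩ := exists_pairs_of_complete U hU
  obtain ⟨f', hf'mem, hf'sub, hf'mul⟩ := hgood
    (fun u => {t | ∀ β ∈ u, ∀ γ ∈ u, γ < β → c (e t).2 γ β})
    (fun u hu => by
      change ∀ᶠ k in U, ∀ᶠ p in D, ∀ β ∈ u, ∀ γ ∈ u, γ < β → c (e (e.symm (p, k))).2 γ β
      have : ∀ᶠ k in U, ∀ β ∈ u, ∀ γ ∈ u, γ < β → c k γ β := by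
        simp only [Filter.eventually_all_finset, Filter.eventually_imp_distrib_left]
        exact fun β hβ γ _ h => hc γ β (hu hβ) h
      filter_upwards [this] with k hk
      simp only [Equiv.apply_symm_apply]
      exact Filter.Eventually.of_forall fun _ => hk)
    (fun u v _ huv t ht β hβ γ hγ => ht β (huv hβ) γ (huv hγ))
  let B : K → Set Ordinal.{u} := fun k =>
    {β | β < (Order.succ #K).ord ∧ ∀ᶠ p in D, e.symm (p, k) ∈ f' {β}}
  have hBle : ∀ k, #(B k) ≤ Cardinal.lift.{u + 1} #K := by
    refine fun k => hB k (B k) (fun β hβ => hβ.1) fun β hβ γ hγ hlt => ?_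
    obtain ⟨p, hp⟩ := (hβ.2.and hγ.2).exists
    have hβ' : (({β} : Finset Ordinal.{u}) : Set Ordinal.{u}) ⊆ Set.Iio (Order.succ #K).ord := by
      simpa using hβ.1
    have hγ' : (({γ} : Finset Ordinal.{u}) : Set Ordinal.{u}) ⊆ Set.Iio (Order.succ #K).ord := by
      simpa using hγ.1
    have hp' : e.symm (p, k) ∈ f' ({β} ∪ {γ}) := hf'mul _ _ hβ' hγ' ▸ hp
    have := hf'sub ({β} ∪ {γ}) (by rw [Finset.coe_union]; exact Set.union_subset hβ' hγ') hp'
    simpa using this β (by simp) γ (by simp) hlt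
  have hcover : Set.Iio (Order.succ #K).ord ⊆ ⋃ k, B k := by
    intro β hβ
    have hmem : ∀ᶠ k in U, ∀ᶠ p in D, e.symm (p, k) ∈ f' {β} := hf'mem {β} (by simpa using hβ)
    obtain ⟨k, hk⟩ := hmem.exists
    exact Set.mem_iUnion.2 ⟨k, hβ, hk⟩
  have hle := Cardinal.mk_le_mk_of_subset hcover
  have hle' : #(⋃ k, B k) ≤ Cardinal.lift.{u + 1} #K := by
    have h := Cardinal.mk_iUnion_le_lift B
    simp only [lift_self_succ] at h
    refine (h.trans (mul_le_mul_right (ciSup_le' hBle) _)).trans ?_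
    rw [← Cardinal.lift_mul, Cardinal.mul_eq_self (Cardinal.aleph0_le_mk K)]
  rw [Cardinal.mk_Iio_ordinal, Cardinal.card_ord] at hle
  exact (Order.lt_succ #K).not_ge (Cardinal.lift_le.1 (hle.trans hle'))

lemma isRegularFilter_bind {I K : Type u} [Infinite I] (U : Ultrafilter K)
    {D : Ultrafilter (Point I)} (hD : (D : Filter (Point I)) ≤ coverFilter I)
    (e : I ≃ Point I × K) :
    IsRegularFilter #I
      (U.bind fun k => D.map fun p => e.symm (p, k) : Ultrafilter I).toFilter := by
  obtain ⟨idx, hidx⟩ := exists_injOn_Iio (K := I) (o := (#I).ord) (by simp)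
  refine ⟨fun i => {t | idx i ∈ (e t).1.1}, fun i _ => ?_, fun t => ?_⟩
  · change ∀ᶠ k in U, ∀ᶠ p in D, idx i ∈ (e (e.symm (p, k))).1.1
    simp only [Equiv.apply_symm_apply]
    refine Filter.Eventually.of_forall fun k => hD ?_
    filter_upwards [Filter.tendsto_comap.eventually (Filter.eventually_ge_atTop {idx i})] with p hp
    exact hp (Finset.mem_singleton_self _)
  · refine Set.Finite.of_finite_image (f := idx) ((e t).1.1.finite_toSet.subset ?_)
      (hidx.mono fun i hi => hi.1)
    rintro _ ⟨i, hi, rfl⟩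
    exact hi.2

lemma isFlexible_bind {I K : Type u} [Infinite I] {U : Ultrafilter K}
    (hU : ∀ p : ℕ → K → Prop, (∀ n, ∀ᶠ k in U, p n k) → ∀ᶠ k in U, ∀ n, p n k)
    {D : Ultrafilter (Point I)} (hD : ∀ f, Resolves (D : Filter (Point I)) f)
    (e : I ≃ Point I × K) :
    IsFlexible #I
      (U.bind fun k => D.map fun p => e.symm (p, k) : Ultrafilter I).toFilter := by
  classical
  intro f hf
  obtain ⟨idx, hidx⟩ := exists_injOn_Iio (K := I) (o := (#I).ord) (by simp)
  have hf' : ∀ᶠ k in U, ∀ n, ∀ᶠ p in D, n < f (e.symm (p, k)) := hU _ hf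
  have hs : ∀ k, ∃ s : Point I → Finset I, (∀ p, (s p).card ≤ f (e.symm (p, k))) ∧
      ((∀ n, ∀ᶠ p in D, n < f (e.symm (p, k))) → ∀ l, ∀ᶠ p in D, l ∈ s p) := by
    intro k
    rcases hD (fun p => f (e.symm (p, k))) with ⟨n, hn⟩ | ⟨s, hs, hl⟩
    · refine ⟨fun _ => ∅, by simp, fun h => ?_⟩
      obtain ⟨p, hp, hp'⟩ := (hn.and (h n)).exists
      exact (hp.not_gt hp').elim
    · exact ⟨s, hs, fun _ => hl⟩
  choose s hs hl using hs
  refine ⟨fun i => {t | idx i ∈ s (e t).2 (e t).1}, fun i _ => ?_, fun t => ?_⟩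
  · change ∀ᶠ k in U, ∀ᶠ p in D, idx i ∈ s (e (e.symm (p, k))).2 (e (e.symm (p, k))).1
    simp only [Equiv.apply_symm_apply]
    filter_upwards [hf'] with k hk using hl k hk _
  · let g : {i : Ordinal.{u} // i < (#I).ord ∧ idx i ∈ s (e t).2 (e t).1} → s (e t).2 (e t).1 :=
      fun i => ⟨idx i, i.2.2⟩
    have hg : Function.Injective g := fun i j hij =>
      Subtype.ext (hidx i.2.1 j.2.1 (congrArg Subtype.val hij))
    have hle := Cardinal.lift_mk_le_lift_mk_of_injective hg
    have hcard := hs (e t).2 (e t).1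
    simp only [Prod.mk.eta, Equiv.symm_apply_apply] at hcard
    simp only [lift_self_succ, Cardinal.mk_coe_finset, Cardinal.lift_natCast] at hle
    exact hle.trans (by exact_mod_cast hcard)

end FlexibleUltrafilter

/-- for `kappa` measurable and `kappa < lam` there is a `lam`-regular,
`lam`-flexible ultrafilter on a set of cardinality `lam` which is not `kappa⁺⁺`-good. -/
theorem flexible_not_good {I : Type u} (kappa lam : Cardinal.{u})
    (hmeas : IsMeasurableCard kappa) (hkl : kappa < lam) (hI : #I = lam) :
    ∃ D : Ultrafilter I,
      IsRegularFilter lam (D : Filter I) ∧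
      IsFlexible lam (D : Filter I) ∧
      ¬ IsGoodFilter (Order.succ kappa) (D : Filter I) := by
  obtain ⟨hκ, K, U, rfl, hprin, hcomp⟩ := hmeas
  subst hI
  have : Infinite K := Cardinal.infinite_iff.2 hκ.le
  have : Infinite I := Cardinal.infinite_iff.2 (hκ.trans hkl).le
  have hsmall : ∀ A : Set K, #A < #K → Aᶜ ∈ U := by
    intro A hA
    have h := hcomp ((fun a => {a}ᶜ) '' A) (by
      rintro _ ⟨a, -, rfl⟩
      exact Ultrafilter.compl_mem_iff_notMem.2 (hprin a)) (Cardinal.mk_image_le.trans_lt hA)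
    refine Filter.mem_of_superset h fun k hk hkA => ?_
    exact hk _ ⟨k, hkA, rfl⟩ rfl
  have hcountable : ∀ p : ℕ → K → Prop, (∀ n, ∀ᶠ k in U, p n k) → ∀ᶠ k in U, ∀ n, p n k := by
    intro p hp
    have h := hcomp (Set.range fun n => {k | p n k}) (by rintro _ ⟨n, rfl⟩; exact hp n)
      ((Set.countable_range _).le_aleph0.trans_lt hκ)
    exact Filter.mem_of_superset h fun k hk n => hk _ ⟨n, rfl⟩
  obtain ⟨D, hD, hres⟩ := FlexibleUltrafilter.exists_ultrafilter_resolves I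
  have hcard : #I = #(FlexibleUltrafilter.Point I × K) := by
    have h : #(FlexibleUltrafilter.Point I) = #I := by simp [FlexibleUltrafilter.Point]
    simp only [Cardinal.mk_prod, Cardinal.lift_id] at h ⊢
    rw [h, Cardinal.mul_eq_left (Cardinal.aleph0_le_mk I) hkl.le (Cardinal.mk_ne_zero K)]
  obtain ⟨e⟩ := Cardinal.eq.1 hcard
  exact ⟨U.bind fun k => D.map fun p => e.symm (p, k),
    FlexibleUltrafilter.isRegularFilter_bind U hD e,
    FlexibleUltrafilter.isFlexible_bind hcountable hres e,
    FlexibleUltrafilter.not_isGoodFilter_bind U hsmall D e⟩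
end

section
/- Let κ be a weakly compact cardinal and let θ, λ be cardinals with ℵ₀ < θ = cf(θ) < κ ≤ λ. Then there is a λ-regular ultrafilter D on λ such that lcf(ℵ₀, D) = θ and every (κ, κ)-pre-cut mod D is realized (i.e. the linear order ℕ^λ/D has no (κ, κ)-cuts). -/
open Cardinal Set

universe u

/-! ### Weakly compact cardinals -/

section WeaklyCompact

variable {κ : Cardinal.{u}}

/-- The partition property of a weakly compact cardinal, moved to the type `κ.ord.ToType`. -/
theorem IsWeaklyCompactCard.exists_homogeneous (h : IsWeaklyCompactCard κ)
    (c : κ.ord.ToType → κ.ord.ToType → Bool) :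
    ∃ U : Set κ.ord.ToType, #U = κ ∧ ∃ v, ∀ ε ∈ U, ∀ ζ ∈ U, ε < ζ → c ε ζ = v := by
  classical
  obtain ⟨U, hU, hcard, v, hv⟩ := h.2 fun a b =>
    if hab : a < κ.ord ∧ b < κ.ord then
      c (Ordinal.ToType.mk ⟨a, hab.1⟩) (Ordinal.ToType.mk ⟨b, hab.2⟩) else true
  let f : U → κ.ord.ToType := fun x => Ordinal.ToType.mk ⟨x, hU x.2⟩
  have hf : Function.Injective f := by
    intro x y hxy
    have := Ordinal.ToType.mk.injective hxy
    exact Subtype.ext (congrArg (fun z : Iio κ.ord => (z : Ordinal)) this)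
  refine ⟨range f, ?_, v, ?_⟩
  · have := Cardinal.mk_range_eq_of_injective hf
    rw [hcard] at this
    exact Cardinal.lift_injective.{u + 1, u} (by simpa using this)
  · rintro _ ⟨x, rfl⟩ _ ⟨y, rfl⟩ hxy
    have hlt : (x : Ordinal) < y := by
      have := Ordinal.ToType.mk.lt_iff_lt.1 hxy
      exact this
    have := hv x x.2 y y.2 hlt
    rw [dif_pos ⟨hU x.2, hU y.2⟩] at this
    exact this

theorem card_Iio_lt (b : κ.ord.ToType) : #(Iio b) < κ := by
  simpa using Cardinal.mk_Iio_lt b (by simp)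

theorem exists_gt_of_card_eq (hκ : ℵ₀ ≤ κ) {H : Set κ.ord.ToType} (hH : #H = κ)
    (b : κ.ord.ToType) : ∃ a ∈ H, b < a := by
  by_contra! hb
  have h1 : #H ≤ #(Iio b ∪ {b} : Set κ.ord.ToType) := by
    refine Cardinal.mk_le_mk_of_subset fun x hx => ?_
    rcases (hb x hx).lt_or_eq with h | h
    · exact Or.inl h
    · exact Or.inr h
  have h2 : #(Iio b ∪ {b} : Set κ.ord.ToType) < κ := by
    refine (Cardinal.mk_union_le _ _).trans_lt (Cardinal.add_lt_of_lt hκ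
      (card_Iio_lt b) ?_)
    rw [Cardinal.mk_singleton]
    exact Cardinal.one_lt_aleph0.trans_le hκ
  exact (hH ▸ h1).not_gt h2

/-- A weakly compact cardinal is regular. -/
theorem IsWeaklyCompactCard.exists_upper_bound (h : IsWeaklyCompactCard κ)
    (s : Set κ.ord.ToType) (hs : #s < κ) : ∃ b, ∀ x ∈ s, x < b := by
  classical
  by_contra! hb
  choose f hfs hf using hb
  obtain ⟨U, hU, v, hv⟩ := h.exists_homogeneous fun a b => decide (f a = f b)
  cases v with
  | true =>
    obtain ⟨a, ha⟩ : U.Nonempty := by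
      rw [← Set.nonempty_coe_sort, ← Cardinal.mk_ne_zero_iff, hU]
      exact (Cardinal.aleph0_pos.trans h.1).ne'
    obtain ⟨x, hx, hxa⟩ := exists_gt_of_card_eq h.1.le hU (max a (f a))
    have h1 := hv a ha x hx ((le_max_left _ _).trans_lt hxa)
    have h2 : f a = f x := by simpa using h1
    exact ((hf x).trans (h2 ▸ le_max_right a (f a))).not_gt hxa
  | false =>
    have hinj : InjOn f U := by
      intro x hx y hy hxy
      rcases lt_trichotomy x y with hlt | rfl | hlt
      · have := hv x hx y hy hlt
        simp [hxy] at this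
      · rfl
      · have := hv y hy x hx hlt
        simp [hxy] at this
    have h1 : #U ≤ #s := Cardinal.mk_le_of_injective
      (f := fun x : U => (⟨f x, hfs x⟩ : s)) fun x y hxy =>
        Subtype.ext (hinj x.2 y.2 (congrArg Subtype.val hxy))
    exact (hU ▸ h1).not_gt hs

/-- Along some unbounded set, any `κ`-sequence of `0`-`1` sequences of length at most `κ`
converges in every coordinate. -/
theorem IsWeaklyCompactCard.exists_eventually_const (h : IsWeaklyCompactCard κ)
    {Ξ : Type u} (hΞ : #Ξ ≤ κ) (s : κ.ord.ToType → Ξ → Bool) :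
    ∃ (H : Set κ.ord.ToType) (t : Ξ → Bool), (∀ b, ∃ a ∈ H, b < a) ∧
      ∀ ξ, ∃ b, ∀ a ∈ H, b ≤ a → s a ξ = t ξ := by
  classical
  obtain ⟨e, he⟩ : ∃ e : Ξ → κ.ord.ToType, Function.Injective e := by
    rw [← Cardinal.mk_ord_toType κ] at hΞ
    obtain ⟨e⟩ := hΞ
    exact ⟨e, e.injective⟩
  obtain ⟨H, hH, v, hv⟩ := h.exists_homogeneous fun a b =>
    decide (∃ ξ, (∀ η, e η < e ξ → s a η = s b η) ∧ s a ξ = false ∧ s b ξ = true)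
  have key : ∀ x : κ.ord.ToType, ∀ ξ, e ξ = x → ∃ r : Bool, ∃ b, ∀ a ∈ H, b ≤ a → s a ξ = r := by
    intro x
    induction x using WellFoundedLT.induction with
    | ind x ih =>
    rintro ξ rfl
    have ih' : ∀ η, e η < e ξ → ∃ r : Bool, ∃ b, ∀ a ∈ H, b ≤ a → s a η = r :=
      fun η hη => ih _ hη η rfl
    choose r β hβ using ih'
    obtain ⟨b, hb⟩ := h.exists_upper_bound (range fun η : {η // e η < e ξ} => β η η.2) <| by
      refine Cardinal.mk_range_le.trans_lt ?_
      refine (Cardinal.mk_le_of_injective (β := Iio (e ξ))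
        (f := fun η : {η // e η < e ξ} => ⟨e η, η.2⟩) ?_).trans_lt
        (card_Iio_lt (e ξ))
      exact fun x y hxy => Subtype.ext (he (congrArg Subtype.val hxy))
    have hagree : ∀ a ∈ H, ∀ a' ∈ H, b ≤ a → b ≤ a' → ∀ η, e η < e ξ → s a η = s a' η := by
      intro a ha a' ha' hba hba' η hη
      have := (hb _ ⟨⟨η, hη⟩, rfl⟩).le
      rw [hβ η hη a ha (this.trans hba), hβ η hη a' ha' (this.trans hba')]
    cases v with
    | true =>
      have mono : ∀ a ∈ H, ∀ a' ∈ H, b ≤ a → a < a' → s a ξ = true → s a' ξ = true := by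
        intro a ha a' ha' hba haa' hsa
        have := hv a ha a' ha' haa'
        rw [decide_eq_true_iff] at this
        obtain ⟨ξ', h1, h2, h3⟩ := this
        rcases lt_trichotomy (e ξ) (e ξ') with hlt | heq | hlt
        · rw [← h1 ξ hlt, hsa]
        · rw [he heq, h3]
        · have := hagree a ha a' ha' hba (hba.trans haa'.le) ξ' hlt
          rw [h2, h3] at this
          cases this
      by_cases hex : ∃ a ∈ H, b ≤ a ∧ s a ξ = true
      · obtain ⟨a, ha, hba, hsa⟩ := hex
        refine ⟨true, a, fun a' ha' haa' => ?_⟩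
        rcases haa'.lt_or_eq with hlt | rfl
        · exact mono a ha a' ha' hba hlt hsa
        · exact hsa
      · refine ⟨false, b, fun a ha hba => ?_⟩
        by_contra hne
        exact hex ⟨a, ha, hba, by simpa using hne⟩
    | false =>
      have anti : ∀ a ∈ H, ∀ a' ∈ H, b ≤ a → a < a' → s a ξ = false → s a' ξ = false := by
        intro a ha a' ha' hba haa' hsa
        have := hv a ha a' ha' haa'
        rw [decide_eq_false_iff_not] at this
        by_contra hne
        exact this ⟨ξ, hagree a ha a' ha' hba (hba.trans haa'.le), hsa, by simpa using hne⟩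
      by_cases hex : ∃ a ∈ H, b ≤ a ∧ s a ξ = false
      · obtain ⟨a, ha, hba, hsa⟩ := hex
        refine ⟨false, a, fun a' ha' haa' => ?_⟩
        rcases haa'.lt_or_eq with hlt | rfl
        · exact anti a ha a' ha' hba hlt hsa
        · exact hsa
      · refine ⟨true, b, fun a ha hba => ?_⟩
        by_contra hne
        exact hex ⟨a, ha, hba, by simpa using hne⟩
  choose t ht using fun ξ => key (e ξ) ξ rfl
  exact ⟨H, t, exists_gt_of_card_eq h.1.le hH, ht⟩

end WeaklyCompact

/-! ### Independent families and handling of pre-cuts -/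

section Independent

open Filter

/-- The set of points at which every `F r` with `r ∈ w` takes the value prescribed by `v`. -/
def cylinder {I N V : Type*} (F : N → I → V) (w : Finset N) (v : N → V) : Set I :=
  {t | ∀ r ∈ w, F r t = v r}

/-- A form of the Engelking–Karłowicz theorem: `2 ^ #I` independent functions on `I`, independent
over a regularizing family. -/
theorem exists_independent_family (I : Type u) [Infinite I] :
    ∃ (X : I → Set I) (F : Set I → I → Finset I), (∀ t, {j | t ∈ X j}.Finite) ∧
      ∀ (u : Finset I) (w : Finset (Set I)) (v : Set I → Finset I),
        ∃ t, (∀ j ∈ u, t ∈ X j) ∧ t ∈ cylinder F w v := by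
  classical
  obtain ⟨e⟩ : Nonempty (I ≃ Finset I × Finset (Finset I × Finset I)) := by
    rw [← Cardinal.eq]
    simp
  let tr : Set I → Finset I → Finset I := fun A s => s.filter (· ∈ A)
  refine ⟨fun j => {t | j ∈ (e t).1}, fun A t =>
    if h : ∃ q, (tr A (e t).1, q) ∈ (e t).2 then h.choose else ∅, fun t => ?_, fun u w v => ?_⟩
  · exact (e t).1.finite_toSet
  have hsep : ∀ A B : Set I, ∃ x, A ≠ B → ¬ (x ∈ A ↔ x ∈ B) := by
    intro A B
    by_cases hAB : A = B
    · exact ⟨Classical.arbitrary I, fun h => (h hAB).elim⟩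
    · by_contra! hne
      exact hAB (Set.ext fun x => (hne x).2)
  choose d hd using hsep
  let s : Finset I := u ∪ (w ×ˢ w).image fun p => d p.1 p.2
  have htr : ∀ A ∈ w, ∀ B ∈ w, tr A s = tr B s → A = B := by
    intro A hA B hB hAB
    by_contra hne
    have hmem : d A B ∈ s := Finset.mem_union_right _
      (Finset.mem_image.2 ⟨(A, B), Finset.mk_mem_product hA hB, rfl⟩)
    have := congrArg (d A B ∈ ·) hAB
    simp only [tr, Finset.mem_filter, hmem, true_and, eq_iff_iff] at this
    exact hd A B hne this
  refine ⟨e.symm (s, w.image fun A => (tr A s, v A)), fun j hj => ?_, fun A hA => ?_⟩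
  · simp only [mem_ofPred_eq, Equiv.apply_symm_apply]
    exact Finset.mem_union_left _ hj
  · simp only [Equiv.apply_symm_apply]
    have hex : ∃ q, (tr A s, q) ∈ w.image fun A => (tr A s, v A) :=
      ⟨v A, Finset.mem_image_of_mem (fun A => (tr A s, v A)) hA⟩
    rw [dif_pos hex]
    obtain ⟨B, hB, hBA⟩ := Finset.mem_image.1 hex.choose_spec
    rw [Prod.ext_iff] at hBA
    exact hBA.2.symm.trans (congrArg v (htr B hB A hA hBA.1))

theorem exists_finset_of_mem_inf_iInf_principal {I ι : Type*} {D : Filter I} {X : ι → Set I}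
    {A : Set I} (h : A ∈ D ⊓ ⨅ i, 𝓟 (X i)) :
    ∃ u : Finset ι, ∀ᶠ t in D, (∀ i ∈ u, t ∈ X i) → t ∈ A := by
  obtain ⟨Z, hZ, Y, hY, rfl⟩ := Filter.mem_inf_iff.1 h
  obtain ⟨u, hu⟩ := (Filter.mem_iInf_finite Y).1 hY
  rw [Filter.iInf_principal_finset, mem_principal] at hu
  refine ⟨u, Filter.mem_of_superset hZ fun t ht h => ⟨ht, hu ?_⟩⟩
  simpa using h

theorem exists_mem_of_mem_inf_iInf {I T : Type*} [LinearOrder T] {D : Filter I}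
    {φ : T → Filter I} {s : Set T} (hD : ∀ i ∈ s, φ i ≤ D)
    (hφ : ∀ i ∈ s, ∀ j ∈ s, i < j → φ j ≤ φ i) {A : Set I} (hA : A ∈ D ⊓ ⨅ i ∈ s, φ i) :
    A ∈ D ∨ ∃ i ∈ s, A ∈ φ i := by
  rcases s.eq_empty_or_nonempty with rfl | ⟨i₀, hi₀⟩
  · left
    simpa using hA
  · right
    have hle : ⨅ i ∈ s, φ i ≤ D := (iInf₂_le i₀ hi₀).trans (hD i₀ hi₀)
    rw [inf_eq_right.2 hle, Filter.mem_biInf_of_directed _ ⟨i₀, hi₀⟩] at hA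
    · exact hA
    · intro i hi j hj
      rcases lt_trichotomy i j with h | rfl | h
      · exact ⟨j, hj, hφ i hi j hj h, le_rfl⟩
      · exact ⟨i, hi, le_rfl, le_rfl⟩
      · exact ⟨i, hi, le_rfl, hφ j hj i hi h⟩

/-- Definition by transfinite recursion along a relation that only looks at earlier values. -/
theorem exists_transfinite {T X : Type*} [LinearOrder T] [WellFoundedLT T] [Nonempty X]
    (Q : T → (T → X) → X → Prop)
    (hcongr : ∀ i φ ψ x, (∀ j < i, φ j = ψ j) → Q i φ x → Q i ψ x)
    (hstep : ∀ i φ, (∀ j < i, Q j φ (φ j)) → ∃ x, Q i φ x) :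
    ∃ φ, ∀ i, Q i φ (φ i) := by
  classical
  let ex : (i : T) → ((j : T) → j < i → X) → T → X := fun i p j =>
    if h : j < i then p j h else Classical.arbitrary X
  let G : (i : T) → ((j : T) → j < i → X) → X := fun i p =>
    if h : ∃ x, Q i (ex i p) x then h.choose else Classical.arbitrary X
  let φ : T → X := (wellFounded_lt (α := T)).fix G
  have hφ : ∀ i, φ i = G i fun j _ => φ j := fun i => WellFounded.fix_eq _ G i
  have hex : ∀ i, ∀ j < i, ex i (fun j _ => φ j) j = φ j := fun i j hj => dif_pos hj
  refine ⟨φ, fun i => ?_⟩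
  induction i using WellFoundedLT.induction with
  | ind i ih =>
  obtain ⟨x, hx⟩ := hstep i φ ih
  have h : ∃ x, Q i (ex i fun j _ => φ j) x :=
    ⟨x, hcongr i _ _ x (fun j hj => (hex i j hj).symm) hx⟩
  rw [hφ i]
  simp only [G, dif_pos h]
  exact hcongr i _ _ _ (hex i) h.choose_spec

variable {I R Θ : Type*}

/-- The functions `f r` with `r ∉ S`, together with all the `g i`, are independent modulo `D`. -/
def IndependentOutside {V : Type*} (D : Filter I) (S : Set R) (f : R → I → V) (g : Θ → I → ℕ) :
    Prop :=
  ∀ w : Finset R, (∀ r ∈ w, r ∉ S) → ∀ v z y, ∃ᶠ t in D, t ∈ cylinder f w v ∧ t ∈ cylinder g z y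

/-- The pre-cut `(a, b)` is filled modulo `D`, or it is inconsistent below some cylinder of `g`. -/
def PrecutHandled (g : Θ → I → ℕ) (a b : I → I → ℕ) (D : Filter I) : Prop :=
  (∃ c : I → ℕ, ∀ ε, ∀ᶠ t in D, a ε t < c t ∧ c t < b ε t) ∨
    ∃ (Q : Finset (I × I)) (z : Finset Θ) (y : Θ → ℕ),
      ∀ᶠ t in D, t ∈ cylinder g z y → ¬ ∀ q ∈ Q, a q.1 t + 1 < b q.2 t

theorem PrecutHandled.mono {g : Θ → I → ℕ} {a b : I → I → ℕ} {D D' : Filter I} (hD : D' ≤ D)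
    (h : PrecutHandled g a b D) : PrecutHandled g a b D' := by
  rcases h with ⟨c, hc⟩ | ⟨Q, z, y, hQ⟩
  · exact Or.inl ⟨c, fun ε => (hc ε).filter_mono hD⟩
  · exact Or.inr ⟨Q, z, y, hQ.filter_mono hD⟩

theorem IndependentOutside.exists_precutHandled {D : Filter I} {S : Set R}
    {f : R → I → Finset I} {g : Θ → I → ℕ} (h : IndependentOutside D S f g)
    (hS : S ≠ Set.univ) (a b : I → I → ℕ) :
    ∃ (D' : Filter I) (k : Finset R), D' ≤ D ∧ IndependentOutside D' (S ∪ k) f g ∧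
      PrecutHandled g a b D' := by
  classical
  by_cases hcase : ∃ (w : Finset R) (v : R → Finset I) (z : Finset Θ) (y : Θ → ℕ)
      (Q : Finset (I × I)), (∀ r ∈ w, r ∉ S) ∧ ∀ᶠ t in D, t ∈ cylinder f w v →
        t ∈ cylinder g z y → ¬ ∀ q ∈ Q, a q.1 t + 1 < b q.2 t
  · obtain ⟨w, v, z, y, Q, hw, hQ⟩ := hcase
    refine ⟨D ⊓ 𝓟 (cylinder f w v), w, inf_le_left, fun w' hw' v' z' y' => ?_,
      Or.inr ⟨Q, z, y, eventually_inf_principal.2 hQ⟩⟩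
    rw [frequently_inf_principal]
    refine (h (w ∪ w') (fun r hr => ?_) (fun r => if r ∈ w then v r else v' r) z' y').mono ?_
    · rcases Finset.mem_union.1 hr with hr | hr
      · exact hw r hr
      · exact fun hrS => hw' r hr (Or.inl hrS)
    · rintro t ⟨ht1, ht2⟩
      refine ⟨fun r hr => ?_, fun r hr => ?_, ht2⟩
      · exact (ht1 r (Finset.mem_union_left _ hr)).trans (if_pos hr)
      · exact (ht1 r (Finset.mem_union_right _ hr)).trans
          (if_neg fun hrw => hw' r hr (Or.inr hrw))
  · push Not at hcase
    obtain ⟨r₀, hr₀⟩ := (Set.ne_univ_iff_exists_notMem S).1 hS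
    let c : I → ℕ := fun t => (f r₀ t).sup fun ε => a ε t + 1
    refine ⟨D ⊓ ⨅ ε, 𝓟 {t | a ε t < c t ∧ c t < b ε t}, {r₀}, inf_le_left,
      fun w hw v z y => ?_, Or.inl ⟨c, fun ε => ?_⟩⟩
    · intro hev
      obtain ⟨u, hu⟩ := exists_finset_of_mem_inf_iInf_principal hev
      have hfr := hcase (insert r₀ w) (Function.update v r₀ u) z y (u ×ˢ u) fun r hr => by
        rcases Finset.mem_insert.1 hr with rfl | hr
        · exact hr₀
        · exact fun hrS => hw r hr (Or.inl hrS)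
      obtain ⟨t, ⟨ht1, ht2, ht3⟩, ht⟩ := (hfr.and_eventually hu).exists
      have hf : f r₀ t = u := by
        rw [ht1 r₀ (Finset.mem_insert_self _ _), Function.update_self]
      refine ht (fun ε hε => ⟨?_, ?_⟩) ⟨fun r hr => ?_, ht2⟩
      · have : a ε t + 1 ≤ c t := by
          simp only [c, hf]
          exact Finset.le_sup (f := fun ε => a ε t + 1) hε
        omega
      · simp only [c, hf]
        rw [Finset.sup_lt_iff]
        · exact fun ε' hε' => ht3 (ε', ε) (Finset.mk_mem_product hε' hε)
        · have := ht3 (ε, ε) (Finset.mk_mem_product hε hε)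
          exact (Nat.zero_le _).trans_lt this
      · rw [ht1 r (Finset.mem_insert_of_mem hr), Function.update_of_ne]
        rintro rfl
        exact hw r hr (Or.inr (by simp))
    · exact mem_inf_of_right (mem_iInf_of_mem ε (mem_principal_self _))

end Independent

/-! ### The base filter -/

section BaseFilter

open Filter

theorem IndependentOutside.inf_iInf {I R Θ V T : Type*} [LinearOrder T] {D : Filter I}
    {S₀ U : Set R} {f : R → I → V} {g : Θ → I → ℕ} {φ : T → Filter I} {s : Set T} {S : T → Set R}
    (h₀ : IndependentOutside D S₀ f g) (hS₀ : S₀ ⊆ U) (hD : ∀ i ∈ s, φ i ≤ D)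
    (hφ : ∀ i ∈ s, ∀ j ∈ s, i < j → φ j ≤ φ i)
    (h : ∀ i ∈ s, IndependentOutside (φ i) (S i) f g) (hS : ∀ i ∈ s, S i ⊆ U) :
    IndependentOutside (D ⊓ ⨅ i ∈ s, φ i) U f g := by
  intro w hw v z y hev
  rcases exists_mem_of_mem_inf_iInf hD hφ hev with hA | ⟨i, hi, hA⟩
  · exact h₀ w (fun r hr hrS => hw r hr (hS₀ hrS)) v z y hA
  · exact h i hi w (fun r hr hrS => hw r hr (hS i hi hrS)) v z y hA

/-- A filter modulo which `g` is independent extends to a maximal such filter, and modulo the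
latter the cylinders of `g` are dense among the positive sets. -/
theorem exists_le_dense_cylinders {I Θ : Type*} {D : Filter I} {g : Θ → I → ℕ}
    (h : ∀ z y, ∃ᶠ t in D, t ∈ cylinder g z y) :
    ∃ E ≤ D, (∀ z y, ∃ᶠ t in E, t ∈ cylinder g z y) ∧
      ∀ A : Set I, (∃ᶠ t in E, t ∈ A) → ∃ z y, ∀ᶠ t in E, t ∈ cylinder g z y → t ∈ A := by
  obtain ⟨E, hED, hE⟩ := zorn_le_nonempty₀ (α := (Filter I)ᵒᵈ)
    {E | ∀ z y, ∃ᶠ t in OrderDual.ofDual E, t ∈ cylinder g z y} (fun c hc hchain E₀ hE₀ => by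
      refine ⟨OrderDual.toDual (⨅ E ∈ c, OrderDual.ofDual E), fun z y hev => ?_, fun E hE => ?_⟩
      · rw [OrderDual.ofDual_toDual] at hev
        have hev' := (Filter.mem_biInf_of_directed (fun E hE E' hE' => by
          rcases hchain.total hE hE' with hle | hle
          · exact ⟨E', hE', hle, le_rfl⟩
          · exact ⟨E, hE, le_rfl, hle⟩) ⟨E₀, hE₀⟩).1 hev
        obtain ⟨E, hE, hA⟩ := hev'
        exact hc hE z y hA
      · exact iInf₂_le (f := fun E (_ : E ∈ c) => OrderDual.ofDual E) E hE)
    (OrderDual.toDual D) h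
  refine ⟨OrderDual.ofDual E, hED, hE.prop, fun A hA => ?_⟩
  by_contra! hne
  refine hA ?_
  have hind : ∀ z y, ∃ᶠ t in OrderDual.ofDual E ⊓ 𝓟 Aᶜ, t ∈ cylinder g z y := by
    intro z y
    rw [frequently_inf_principal]
    exact (hne z y).mono fun t ht => ⟨ht.2, ht.1⟩
  have hle := hE.le_of_ge (y := OrderDual.toDual (OrderDual.ofDual E ⊓ 𝓟 Aᶜ)) hind
    (inf_le_left : OrderDual.ofDual E ⊓ 𝓟 Aᶜ ≤ OrderDual.ofDual E)
  have hle' : OrderDual.ofDual E ≤ OrderDual.ofDual E ⊓ 𝓟 Aᶜ := hle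
  exact (hle'.trans inf_le_right) (mem_principal_self _)

/-- There is a regular filter together with functions `g i` that are independent modulo it, whose
cylinders are dense among the positive sets, and modulo which all pre-cuts are filled. -/
theorem exists_base_filter (I Θ : Type u) [Infinite I] (hΘ : #Θ ≤ 2 ^ #I) :
    ∃ (D : Filter I) (g : Θ → I → ℕ) (X : I → Set I), (∀ j, X j ∈ D) ∧
      (∀ t, {j | t ∈ X j}.Finite) ∧ (∀ z y, ∃ᶠ t in D, t ∈ cylinder g z y) ∧
      (∀ A : Set I, (∃ᶠ t in D, t ∈ A) → ∃ z y, ∀ᶠ t in D, t ∈ cylinder g z y → t ∈ A) ∧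
      ∀ a b : I → I → ℕ, (∀ ε ζ, ∀ᶠ t in D, a ε t + 1 < b ζ t) →
        ∃ c : I → ℕ, ∀ ε, ∀ᶠ t in D, a ε t < c t ∧ c t < b ε t := by
  classical
  obtain ⟨X, F, hX, hF⟩ := exists_independent_family I
  have hinf : ℵ₀ ≤ 2 ^ #I := (Cardinal.aleph0_le_mk I).trans (Cardinal.cantor _).le
  obtain ⟨emb⟩ : Nonempty (Set I ⊕ Θ ↪ Set I) := by
    rw [← Cardinal.le_def]
    simp only [Cardinal.mk_sum, Cardinal.mk_set, Cardinal.lift_id]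
    exact (Cardinal.add_le_max _ _).trans (by simp [hΘ, hinf])
  let f : Set I → I → Finset I := fun r => F (emb (Sum.inl r))
  let g : Θ → I → ℕ := fun i t => (F (emb (Sum.inr i)) t).card
  let D₀ : Filter I := ⊤ ⊓ ⨅ j, 𝓟 (X j)
  have hD₀ : IndependentOutside D₀ ∅ f g := by
    intro w _ v z y hev
    obtain ⟨u, hu⟩ := exists_finset_of_mem_inf_iInf_principal hev
    rw [eventually_top] at hu
    choose s hs using fun n : ℕ => Infinite.exists_subset_card_eq I n
    obtain ⟨t, ht1, ht2⟩ := hF u (w.image (fun r => emb (Sum.inl r)) ∪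
      z.image (fun i => emb (Sum.inr i)))
      (fun A => if h : ∃ x, emb x = A then Sum.elim v (fun i => s (y i)) h.choose else ∅)
    have hval : ∀ x, (if h : ∃ x', emb x' = emb x then Sum.elim v (fun i => s (y i)) h.choose
        else ∅) = Sum.elim v (fun i => s (y i)) x := by
      intro x
      have hex : ∃ x', emb x' = emb x := ⟨x, rfl⟩
      rw [dif_pos hex, emb.injective hex.choose_spec]
    refine hu t ht1 ⟨fun r hr => ?_, fun i hi => ?_⟩
    · exact (ht2 (emb (Sum.inl r)) (Finset.mem_union_left _
        (Finset.mem_image_of_mem (fun r => emb (Sum.inl r)) hr))).trans (hval _)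
    · have := (ht2 (emb (Sum.inr i)) (Finset.mem_union_right _
        (Finset.mem_image_of_mem (fun i => emb (Sum.inr i)) hi))).trans (hval _)
      simp only [g, this, Sum.elim_inr]
      exact hs _
  let T := ((2 : Cardinal.{u}) ^ #I).ord.ToType
  obtain ⟨e⟩ : Nonempty (T ≃ (I → I → ℕ) × (I → I → ℕ)) := by
    rw [← Cardinal.eq]
    have h1 : #(I → I → ℕ) = 2 ^ #I := by
      have h2 : (ℵ₀ : Cardinal.{u}) ^ #I = 2 ^ #I :=
        Cardinal.power_eq_two_power (Cardinal.aleph0_le_mk I) Cardinal.ofNat_le_aleph0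
          (Cardinal.aleph0_le_mk I)
      simp only [Cardinal.mk_arrow, Cardinal.mk_nat, Cardinal.lift_aleph0, Cardinal.lift_uzero, h2,
        Cardinal.lift_id, ← Cardinal.power_mul, Cardinal.mul_eq_self (Cardinal.aleph0_le_mk I)]
    simp only [T, Cardinal.mk_prod, h1, Cardinal.lift_id, Cardinal.mk_ord_toType]
    exact (Cardinal.mul_eq_self hinf).symm
  obtain ⟨φ, hφ⟩ := exists_transfinite (T := T) (X := Filter I × Finset (Set I))
    (fun i φ x => x.1 ≤ D₀ ⊓ ⨅ j ∈ Set.Iio i, (φ j).1 ∧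
      IndependentOutside x.1 ((⋃ j ∈ Set.Iio i, ((φ j).2 : Set (Set I))) ∪ x.2) f g ∧
      PrecutHandled g (e i).1 (e i).2 x.1) (fun i φ ψ x hφψ => by
        have h1 : ⨅ j ∈ Set.Iio i, (φ j).1 = ⨅ j ∈ Set.Iio i, (ψ j).1 :=
          iInf_congr fun j => iInf_congr fun hj => by rw [hφψ j hj]
        have h2 : ⋃ j ∈ Set.Iio i, ((φ j).2 : Set (Set I)) =
            ⋃ j ∈ Set.Iio i, ((ψ j).2 : Set (Set I)) :=
          Set.iUnion₂_congr fun j hj => by rw [hφψ j hj]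
        rw [h1, h2]
        exact id) (fun i φ hφ => by
        have hind := hD₀.inf_iInf (U := ⋃ j ∈ Set.Iio i, ((φ j).2 : Set (Set I)))
          (φ := fun j => (φ j).1) (s := Set.Iio i) (Set.empty_subset _)
          (fun j hj => (hφ j hj).1.trans inf_le_left)
          (fun j hj k hk hjk => (hφ k hk).1.trans (inf_le_right.trans (iInf₂_le j hjk)))
          (fun j hj => (hφ j hj).2.1) (fun j hj => by
            refine Set.union_subset (Set.iUnion₂_subset fun k hk => ?_) ?_
            · exact Set.subset_biUnion_of_mem (u := fun j => ((φ j).2 : Set (Set I)))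
                (show k ∈ Set.Iio i from (Set.mem_Iio.1 hk).trans (Set.mem_Iio.1 hj))
            · exact Set.subset_biUnion_of_mem (u := fun j => ((φ j).2 : Set (Set I))) hj)
        have hne : ⋃ j ∈ Set.Iio i, ((φ j).2 : Set (Set I)) ≠ Set.univ := by
          intro heq
          have hle : #(⋃ j ∈ Set.Iio i, ((φ j).2 : Set (Set I)) : Set (Set I)) ≤
              #(Set.Iio i) * ℵ₀ := (Cardinal.mk_biUnion_le _ _).trans
            (mul_le_mul_right (ciSup_le' fun j => (Cardinal.lt_aleph0_of_finite _).le) _)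
          rw [heq, Cardinal.mk_univ, Cardinal.mk_set] at hle
          exact hle.not_gt (Cardinal.mul_lt_of_lt hinf (card_Iio_lt i)
            ((Cardinal.aleph0_le_mk I).trans_lt (Cardinal.cantor _)))
        obtain ⟨D', k, hD', hk, hcut⟩ := hind.exists_precutHandled hne (e i).1 (e i).2
        exact ⟨(D', k), hD', hk, hcut⟩)
  have hind := hD₀.inf_iInf (U := Set.univ) (φ := fun j => (φ j).1) (s := Set.univ)
    (Set.empty_subset _)
    (fun j _ => (hφ j).1.trans inf_le_left)
    (fun j _ k _ hjk => (hφ k).1.trans (inf_le_right.trans (iInf₂_le j hjk)))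
    (fun j _ => (hφ j).2.1) (fun j _ => Set.subset_univ _)
  obtain ⟨D, hD, hD1, hD2⟩ := exists_le_dense_cylinders (g := g) fun z y =>
    (hind ∅ (by simp) (fun _ => ∅) z y).mono fun t ht => ht.2
  refine ⟨D, g, X, fun j => ?_, hX, hD1, hD2, fun a b hab => ?_⟩
  · exact hD (mem_inf_of_left (mem_inf_of_right (mem_iInf_of_mem j (mem_principal_self _))))
  · have hle : D ≤ (φ (e.symm (a, b))).1 :=
      hD.trans (inf_le_right.trans (iInf₂_le (e.symm (a, b)) (Set.mem_univ _)))
    have hcut := ((hφ (e.symm (a, b))).2.2).mono hle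
    rw [Equiv.apply_symm_apply] at hcut
    rcases hcut with hc | ⟨Q, z, y, hQ⟩
    · exact hc
    · have hall : ∀ᶠ t in D, ∀ q ∈ Q, a q.1 t + 1 < b q.2 t :=
        (Finset.eventually_all Q).2 fun q _ => hab q.1 q.2
      obtain ⟨t, ht1, ht2, ht3⟩ := ((hD1 z y).and_eventually (hall.and hQ)).exists
      exact (ht3 ht1 ht2).elim

end BaseFilter

/-! ### Sets supported by a subfamily -/

section Support

open Filter

variable {I Θ : Type*} {D : Filter I} {g : Θ → I → ℕ}

/-- Modulo `D`, the set `C` is contained in `A` or in its complement. -/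
def DecidesMod (D : Filter I) (C A : Set I) : Prop :=
  (∀ᶠ t in D, t ∈ C → t ∈ A) ∨ ∀ᶠ t in D, t ∈ C → t ∉ A

theorem DecidesMod.mono {C C' A : Set I} (h : DecidesMod D C A) (hC : C' ⊆ C) :
    DecidesMod D C' A := by
  rcases h with h | h
  · exact Or.inl (h.mono fun t ht h' => ht (hC h'))
  · exact Or.inr (h.mono fun t ht h' => ht (hC h'))

theorem cylinder_subset {w w' : Finset Θ} {x x' : Θ → ℕ} (hw : w ⊆ w')
    (hx : ∀ i ∈ w, x' i = x i) : cylinder g w' x' ⊆ cylinder g w x :=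
  fun _ ht i hi => (ht i (hw hi)).trans (hx i hi)

/-- The sets that are decided, modulo `D`, by a dense family of cylinders of `g` based on finite
subsets of `W`. -/
def supportedSets (D : Filter I) (g : Θ → I → ℕ) (W : Set Θ) : Set (Set I) :=
  {A | ∀ w : Finset Θ, ↑w ⊆ W → ∀ x : Θ → ℕ, ∃ (w' : Finset Θ) (x' : Θ → ℕ), w ⊆ w' ∧ ↑w' ⊆ W ∧
    (∀ i ∈ w, x' i = x i) ∧ DecidesMod D (cylinder g w' x') A}

theorem supportedSets_mono {W W' : Set Θ} (hW : W ⊆ W') :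
    supportedSets D g W ⊆ supportedSets D g W' := by
  classical
  intro A hA w hw x
  obtain ⟨w₁, x₁, hww₁, hw₁, hx₁, hdec⟩ := hA (w.filter (· ∈ W)) (fun i hi => by simp_all) x
  refine ⟨w ∪ w₁, fun i => if i ∈ w₁ then x₁ i else x i, Finset.subset_union_left, ?_,
    fun i hi => ?_, hdec.mono (cylinder_subset Finset.subset_union_right fun i hi => if_pos hi)⟩
  · rw [Finset.coe_union]
    exact Set.union_subset hw (hw₁.trans hW)
  · by_cases hi₁ : i ∈ w₁
    · exact (if_pos hi₁).trans (hx₁ i (Finset.mem_filter.2 ⟨hi, hw₁ hi₁⟩))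
    · exact if_neg hi₁

theorem univ_mem_supportedSets (W : Set Θ) : Set.univ ∈ supportedSets D g W :=
  fun w hw x => ⟨w, x, Finset.Subset.refl w, hw, fun _ _ => rfl,
    Or.inl (Eventually.of_forall fun _ _ => Set.mem_univ _)⟩

theorem compl_mem_supportedSets {W : Set Θ} {A : Set I} (hA : A ∈ supportedSets D g W) :
    Aᶜ ∈ supportedSets D g W := by
  intro w hw x
  obtain ⟨w', x', h1, h2, h3, h4⟩ := hA w hw x
  refine ⟨w', x', h1, h2, h3, ?_⟩
  rcases h4 with h4 | h4
  · exact Or.inr (h4.mono fun t ht h h' => h' (ht h))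
  · exact Or.inl h4

theorem inter_mem_supportedSets {W : Set Θ} {A B : Set I} (hA : A ∈ supportedSets D g W)
    (hB : B ∈ supportedSets D g W) : A ∩ B ∈ supportedSets D g W := by
  intro w hw x
  obtain ⟨w₁, x₁, h1, h2, h3, h4⟩ := hA w hw x
  obtain ⟨w₂, x₂, k1, k2, k3, k4⟩ := hB w₁ h2 x₁
  refine ⟨w₂, x₂, h1.trans k1, k2, fun i hi => (k3 i (h1 hi)).trans (h3 i hi), ?_⟩
  rcases h4.mono (cylinder_subset k1 k3) with h4 | h4
  · rcases k4 with k4 | k4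
    · exact Or.inl (by filter_upwards [h4, k4] with t ht kt h using ⟨ht h, kt h⟩)
    · exact Or.inr (k4.mono fun t ht h h' => ht h h'.2)
  · exact Or.inr (h4.mono fun t ht h h' => ht h h'.1)

theorem mem_supportedSets_of_mem {W : Set Θ} {i : Θ} (hi : i ∈ W) (P : ℕ → Prop) :
    {t | P (g i t)} ∈ supportedSets D g W := by
  classical
  intro w hw x
  refine ⟨insert i w, x, Finset.subset_insert i w, ?_, fun _ _ => rfl, ?_⟩
  · rw [Finset.coe_insert]
    exact Set.insert_subset hi hw
  · have hx : ∀ t ∈ cylinder g (insert i w) x, g i t = x i :=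
      fun t ht => ht i (Finset.mem_insert_self i w)
    by_cases hP : P (x i)
    · exact Or.inl (Eventually.of_forall fun t ht => by
        rw [mem_ofPred_eq, hx t ht]; exact hP)
    · exact Or.inr (Eventually.of_forall fun t ht => by
        rw [mem_ofPred_eq, hx t ht]; exact hP)

theorem le_mem_supportedSets {W : Set Θ} {j : Θ} (hj : j ∈ W) {f : I → ℕ}
    (hf : ∀ n, {t | n ≤ f t} ∈ supportedSets D g W) :
    {t | g j t ≤ f t} ∈ supportedSets D g W := by
  classical
  intro w hw x
  obtain ⟨w', x', h1, h2, h3, h4⟩ := hf (x j) (insert j w)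
    (by rw [Finset.coe_insert]; exact Set.insert_subset hj hw) x
  refine ⟨w', x', (Finset.subset_insert j w).trans h1, h2,
    fun i hi => h3 i (Finset.mem_insert_of_mem hi), ?_⟩
  have hx : ∀ t ∈ cylinder g w' x', g j t = x j := fun t ht =>
    (ht j (h1 (Finset.mem_insert_self j w))).trans (h3 j (Finset.mem_insert_self j w))
  rcases h4 with h4 | h4
  · exact Or.inl (h4.mono fun t ht h => by rw [mem_ofPred_eq, hx t h]; exact ht h)
  · exact Or.inr (h4.mono fun t ht h => by rw [mem_ofPred_eq, hx t h]; exact ht h)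

theorem exists_decidesMod
    (hind : ∀ z y, ∃ᶠ t in D, t ∈ cylinder g z y)
    (hdense : ∀ A : Set I, (∃ᶠ t in D, t ∈ A) → ∃ z y, ∀ᶠ t in D, t ∈ cylinder g z y → t ∈ A)
    (A : Set I) (w : Finset Θ) (x : Θ → ℕ) :
    ∃ (w' : Finset Θ) (x' : Θ → ℕ), w ⊆ w' ∧ (∀ i ∈ w, x' i = x i) ∧
      DecidesMod D (cylinder g w' x') A := by
  classical
  by_cases h : ∀ᶠ t in D, t ∈ cylinder g w x → t ∉ A
  · exact ⟨w, x, Finset.Subset.refl w, fun _ _ => rfl, Or.inr h⟩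
  · obtain ⟨z, y, hzy⟩ := hdense (cylinder g w x ∩ A) (by
      rw [Filter.not_eventually] at h
      exact h.mono fun t ht => by push Not at ht; exact ht)
    obtain ⟨t, ht1, ht2⟩ := ((hind z y).and_eventually hzy).exists
    refine ⟨w ∪ z, fun i => g i t, Finset.subset_union_left, fun i hi => (ht2 ht1).1 i hi,
      Or.inl (hzy.mono fun s hs hs' => (hs ?_).2)⟩
    exact cylinder_subset Finset.subset_union_right (fun i hi => ht1 i hi) hs'

theorem exists_cylinder_of_frequently
    (hind : ∀ z y, ∃ᶠ t in D, t ∈ cylinder g z y)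
    (hdense : ∀ A : Set I, (∃ᶠ t in D, t ∈ A) → ∃ z y, ∀ᶠ t in D, t ∈ cylinder g z y → t ∈ A)
    {W : Set Θ} {A : Set I} (hA : A ∈ supportedSets D g W)
    (hpos : ∃ᶠ t in D, t ∈ A) :
    ∃ (w : Finset Θ) (x : Θ → ℕ), ↑w ⊆ W ∧ ∀ᶠ t in D, t ∈ cylinder g w x → t ∈ A := by
  classical
  obtain ⟨z, y, hzy⟩ := hdense A hpos
  obtain ⟨w, x, h1, h2, h3, h4 | h4⟩ := hA (z.filter (· ∈ W)) (fun i hi => by simp_all) y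
  · exact ⟨w, x, h2, h4⟩
  · obtain ⟨t, ht, ht1, ht2⟩ := ((hind (z ∪ w) fun i => if i ∈ w then x i else y i).and_eventually
      (hzy.and h4)).exists
    refine (ht2 (cylinder_subset Finset.subset_union_right (fun i hi => if_pos hi) ht)
      (ht1 (cylinder_subset Finset.subset_union_left (fun i hi => ?_) ht))).elim
    by_cases hiw : i ∈ w
    · exact (if_pos hiw).trans (h3 i (Finset.mem_filter.2 ⟨hi, h2 hiw⟩))
    · exact if_neg hiw

theorem exists_countable_supportedSets
    (hind : ∀ z y, ∃ᶠ t in D, t ∈ cylinder g z y)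
    (hdense : ∀ A : Set I, (∃ᶠ t in D, t ∈ A) → ∃ z y, ∀ᶠ t in D, t ∈ cylinder g z y → t ∈ A)
    (A : Set I) :
    ∃ W : Set Θ, W.Countable ∧ A ∈ supportedSets D g W := by
  classical
  choose e x' hwe hx' hdec using exists_decidesMod hind hdense A
  let v : Finset (Θ × ℕ) → Θ → ℕ := fun c =>
    if h : ∃ x : Θ → ℕ, ∀ p ∈ c, x p.1 = p.2 then h.choose else 0
  let next : Set Θ → Set Θ := fun W =>
    W ∪ ⋃ c ∈ {c : Finset (Θ × ℕ) | ↑c ⊆ W ×ˢ (Set.univ : Set ℕ)}, ↑(e (c.image Prod.fst) (v c))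
  let Ws : ℕ → Set Θ := fun n => next^[n] ∅
  have hsucc : ∀ n, Ws (n + 1) = next (Ws n) := fun n => Function.iterate_succ_apply' next n ∅
  have hcount : ∀ n, (Ws n).Countable := by
    intro n
    induction n with
    | zero => exact Set.countable_empty
    | succ n ih =>
      rw [hsucc]
      refine ih.union (Set.Countable.biUnion ?_ fun c _ => Finset.countable_toSet _)
      have hfin : {c : Set (Θ × ℕ) | c.Finite ∧ c ⊆ Ws n ×ˢ (Set.univ : Set ℕ)}.Countable :=
        Set.countable_ofPred_finite_subset (ih.prod Set.countable_univ)
      refine Set.Countable.mono (fun c hc => ?_) (hfin.preimage_of_injOn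
        (f := fun c : Finset (Θ × ℕ) => (c : Set (Θ × ℕ))) Finset.coe_injective.injOn)
      exact ⟨c.finite_toSet, hc⟩
  have hmono : Monotone Ws := monotone_nat_of_le_succ fun n => by
    rw [hsucc]
    exact Set.subset_union_left
  refine ⟨⋃ n, Ws n, Set.countable_iUnion hcount, fun w hw x => ?_⟩
  obtain ⟨n, hn⟩ : ∃ n, ↑w ⊆ Ws n := by
    exact (hmono.directed_le).exists_mem_subset_of_finset_subset_biUnion hw
  let c : Finset (Θ × ℕ) := w.image fun i => (i, x i)
  have hc : ∃ x : Θ → ℕ, ∀ p ∈ c, x p.1 = p.2 := ⟨x, by simp [c]⟩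
  have hfst : c.image Prod.fst = w := by simp [c, Finset.image_image, Function.comp_def]
  have hv : ∀ i ∈ w, v c i = x i := by
    intro i hi
    have : v c = hc.choose := dif_pos hc
    rw [this]
    exact hc.choose_spec (i, x i) (Finset.mem_image_of_mem _ hi)
  refine ⟨e w (v c), x' w (v c), hwe _ _, ?_, fun i hi => (hx' _ _ i hi).trans (hv i hi),
    hdec _ _⟩
  refine Set.Subset.trans ?_ (Set.subset_iUnion Ws (n + 1))
  rw [hsucc]
  refine Set.Subset.trans ?_ Set.subset_union_right
  have hcW : c ∈ {c : Finset (Θ × ℕ) | ↑c ⊆ Ws n ×ˢ (Set.univ : Set ℕ)} := by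
    intro p hp
    obtain ⟨i, hi, rfl⟩ := Finset.mem_image.1 (Finset.mem_coe.1 hp)
    exact ⟨hn hi, Set.mem_univ _⟩
  have := Set.subset_biUnion_of_mem (u := fun c : Finset (Θ × ℕ) =>
    (↑(e (c.image Prod.fst) (v c)) : Set Θ)) hcW
  simpa only [hfst] using this

end Support

/-! ### The tower of ultrafilters -/

section Tower

open Filter

variable {I Θ : Type*} [LinearOrder Θ] {D : Filter I} {g : Θ → I → ℕ}

/-- The filter describing a value of `g j` that is larger than every natural number, but smaller
than every nonstandard number of `V` supported by the earlier functions `g i`, `i < j`. -/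
def freshFilter (D : Filter I) (g : Θ → I → ℕ) (j : Θ) (V : Filter I) : Filter I where
  sets := {Y | ∃ N, ∀ n ≥ N, ∃ A ∈ supportedSets D g (Set.Iio j), A ∈ V ∧
    ∀ᶠ t in D, t ∈ A → g j t = n → t ∈ Y}
  univ_sets := ⟨0, fun _ _ => ⟨Set.univ, univ_mem_supportedSets _, univ_mem,
    Eventually.of_forall fun _ _ _ => Set.mem_univ _⟩⟩
  sets_of_superset := by
    rintro Y Z ⟨N, hN⟩ hYZ
    refine ⟨N, fun n hn => ?_⟩
    obtain ⟨A, hA, hAV, hAY⟩ := hN n hn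
    exact ⟨A, hA, hAV, hAY.mono fun t ht h h' => hYZ (ht h h')⟩
  inter_sets := by
    rintro Y Z ⟨N, hN⟩ ⟨M, hM⟩
    refine ⟨max N M, fun n hn => ?_⟩
    obtain ⟨A, hA, hAV, hAY⟩ := hN n ((le_max_left _ _).trans hn)
    obtain ⟨B, hB, hBV, hBZ⟩ := hM n ((le_max_right _ _).trans hn)
    refine ⟨A ∩ B, inter_mem_supportedSets hA hB, inter_mem hAV hBV, ?_⟩
    filter_upwards [hAY, hBZ] with t h1 h2 h h' using ⟨h1 h.1 h', h2 h.2 h'⟩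

theorem mem_freshFilter {j : Θ} {V : Filter I} {Y : Set I} : Y ∈ freshFilter D g j V ↔
    ∃ N, ∀ n ≥ N, ∃ A ∈ supportedSets D g (Set.Iio j), A ∈ V ∧
      ∀ᶠ t in D, t ∈ A → g j t = n → t ∈ Y :=
  Iff.rfl

/-- The filter generated modulo `D` by the members of `freshFilter D g j V` that are supported by
the functions `g i`, `i ≤ j`. -/
def towerFilter (D : Filter I) (g : Θ → I → ℕ) (j : Θ) (V : Filter I) : Filter I where
  sets := {S | ∃ Y ∈ supportedSets D g (Set.Iic j), Y ∈ freshFilter D g j V ∧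
    ∀ᶠ t in D, t ∈ Y → t ∈ S}
  univ_sets := ⟨Set.univ, univ_mem_supportedSets _, univ_mem,
    Eventually.of_forall fun _ _ => Set.mem_univ _⟩
  sets_of_superset := by
    rintro S S' ⟨Y, hY, hYf, hYS⟩ hS
    exact ⟨Y, hY, hYf, hYS.mono fun t ht h => hS (ht h)⟩
  inter_sets := by
    rintro S S' ⟨Y, hY, hYf, hYS⟩ ⟨Z, hZ, hZf, hZS⟩
    refine ⟨Y ∩ Z, inter_mem_supportedSets hY hZ, inter_mem hYf hZf, ?_⟩
    filter_upwards [hYS, hZS] with t h1 h2 h using ⟨h1 h.1, h2 h.2⟩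

theorem mem_towerFilter {j : Θ} {V : Filter I} {S : Set I} : S ∈ towerFilter D g j V ↔
    ∃ Y ∈ supportedSets D g (Set.Iic j), Y ∈ freshFilter D g j V ∧ ∀ᶠ t in D, t ∈ Y → t ∈ S :=
  Iff.rfl

theorem mem_towerFilter_of_mem {j : Θ} {V : Filter I} {Y : Set I}
    (hY : Y ∈ supportedSets D g (Set.Iic j)) (hYf : Y ∈ freshFilter D g j V) :
    Y ∈ towerFilter D g j V :=
  ⟨Y, hY, hYf, Eventually.of_forall fun _ => id⟩

theorem towerFilter_le (j : Θ) (V : Filter I) : towerFilter D g j V ≤ D :=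
  fun _ hS => ⟨Set.univ, univ_mem_supportedSets _, univ_mem, mem_of_superset hS fun _ ht _ => ht⟩

theorem freshFilter_le_towerFilter (j : Θ) (V : Filter I) :
    freshFilter D g j V ≤ towerFilter D g j V := by
  rintro S ⟨Y, -, ⟨N, hN⟩, hYS⟩
  refine ⟨N, fun n hn => ?_⟩
  obtain ⟨A, hA, hAV, hAY⟩ := hN n hn
  exact ⟨A, hA, hAV, by filter_upwards [hAY, hYS] with t h1 h2 h h' using h2 (h1 h h')⟩

theorem mem_freshFilter_of_mem {j : Θ} {V : Filter I} {A : Set I}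
    (hA : A ∈ supportedSets D g (Set.Iio j)) (hAV : A ∈ V) : A ∈ freshFilter D g j V :=
  ⟨0, fun _ _ => ⟨A, hA, hAV, Eventually.of_forall fun _ h _ => h⟩⟩

theorem mem_towerFilter_of_mem_left {j : Θ} {V : Filter I} {A : Set I}
    (hA : A ∈ supportedSets D g (Set.Iio j)) (hAV : A ∈ V) : A ∈ towerFilter D g j V :=
  mem_towerFilter_of_mem (supportedSets_mono Set.Iio_subset_Iic_self hA)
    (mem_freshFilter_of_mem hA hAV)

theorem towerFilter_anti {i j : Θ} (hij : i < j) {V W : Filter I}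
    (hW : W ≤ towerFilter D g i V) : towerFilter D g j W ≤ towerFilter D g i V := by
  rintro S ⟨Y, hY, hYf, hYS⟩
  have hYj : Y ∈ supportedSets D g (Set.Iio j) :=
    supportedSets_mono (fun k hk => lt_of_le_of_lt hk hij) hY
  obtain ⟨Z, hZ, hZf, hZY⟩ := mem_towerFilter.1
    (mem_towerFilter_of_mem_left hYj (hW (mem_towerFilter_of_mem hY hYf)))
  exact ⟨Z, hZ, hZf, by filter_upwards [hZY, hYS] with t h1 h2 h using h2 (h1 h)⟩

theorem nonstandard_towerFilter (j : Θ) (V : Filter I) (n : ℕ) :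
    ∀ᶠ t in towerFilter D g j V, n < g j t :=
  mem_towerFilter_of_mem (mem_supportedSets_of_mem (Set.mem_Iic.2 le_rfl) fun m => n < m)
    ⟨n + 1, fun m hm => ⟨Set.univ, univ_mem_supportedSets _, univ_mem,
      Eventually.of_forall fun t _ ht => by rw [mem_ofPred_eq, ht]; exact hm⟩⟩

theorem le_towerFilter {j : Θ} {V : Filter I} {f : I → ℕ}
    (hf : ∀ n, {t | n ≤ f t} ∈ supportedSets D g (Set.Iio j)) (hV : ∀ n, {t | n ≤ f t} ∈ V) :
    ∀ᶠ t in towerFilter D g j V, g j t ≤ f t :=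
  mem_towerFilter_of_mem (le_mem_supportedSets (Set.mem_Iic.2 le_rfl) fun n =>
      supportedSets_mono Set.Iio_subset_Iic_self (hf n))
    ⟨0, fun n _ => ⟨_, hf n, hV n,
      Eventually.of_forall fun t h h' => by rw [mem_ofPred_eq, h']; exact h⟩⟩

theorem neBot_towerFilter (hind : ∀ z y, ∃ᶠ t in D, t ∈ cylinder g z y)
    (hdense : ∀ A : Set I, (∃ᶠ t in D, t ∈ A) → ∃ z y, ∀ᶠ t in D, t ∈ cylinder g z y → t ∈ A)
    (j : Θ) {V : Filter I} [V.NeBot] (hV : V ≤ D) : (towerFilter D g j V).NeBot := by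
  classical
  refine NeBot.mono ⟨fun hbot => ?_⟩ (freshFilter_le_towerFilter j V)
  obtain ⟨N, hN⟩ := mem_freshFilter.1 (Filter.empty_mem_iff_bot.2 hbot)
  obtain ⟨A, hA, hAV, hAD⟩ := hN N le_rfl
  have hpos : ∃ᶠ t in D, t ∈ A := (Eventually.frequently (f := V) hAV).filter_mono hV
  obtain ⟨w, x, hw, hwA⟩ := exists_cylinder_of_frequently hind hdense hA hpos
  obtain ⟨t, ht, h1, h2⟩ := ((hind (insert j w) (Function.update x j N)).and_eventually
    (hwA.and hAD)).exists
  refine h2 (h1 (cylinder_subset (Finset.subset_insert j w) (fun i hi => ?_) ht)) ?_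
  · exact Function.update_of_ne (hw hi).ne _ _
  · exact (ht j (Finset.mem_insert_self j w)).trans (Function.update_self _ _ _)

/-- Extending a filter modulo which `g` is independent, with dense cylinders, to an ultrafilter
such that the `g i` form a decreasing coinitial sequence of nonstandard functions. -/
theorem exists_ultrafilter_coinitial [WellFoundedLT Θ]
    (hΘ : ∀ W : Set Θ, W.Countable → ∃ j, ∀ i ∈ W, i < j)
    (hind : ∀ z y, ∃ᶠ t in D, t ∈ cylinder g z y)
    (hdense : ∀ A : Set I, (∃ᶠ t in D, t ∈ A) → ∃ z y, ∀ᶠ t in D, t ∈ cylinder g z y → t ∈ A) :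
    ∃ U : Ultrafilter I, (U : Filter I) ≤ D ∧ (∀ i n, ∀ᶠ t in (U : Filter I), n < g i t) ∧
      (∀ f : I → ℕ, (∀ n, ∀ᶠ t in (U : Filter I), n < f t) →
        ∃ j, ∀ᶠ t in (U : Filter I), g j t ≤ f t) ∧
      ∀ i j, i < j → ∀ᶠ t in (U : Filter I), g j t < g i t := by
  have hI : Nonempty I := ⟨(hind ∅ 0).exists.choose⟩
  have hneBot : ∀ (V : Θ → Ultrafilter I) (s : Set Θ),
      (∀ j ∈ s, (V j : Filter I) ≤ D ⊓ ⨅ i ∈ Set.Iio j, towerFilter D g i (V i)) →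
      (D ⊓ ⨅ i ∈ s, towerFilter D g i (V i)).NeBot := by
    intro V s hV
    refine ⟨fun hbot => ?_⟩
    rcases exists_mem_of_mem_inf_iInf (fun i _ => towerFilter_le i _)
      (fun i _ j hj hij => towerFilter_anti hij
        ((hV j hj).trans (inf_le_right.trans (iInf₂_le i hij))))
      (Filter.empty_mem_iff_bot.2 hbot) with h | ⟨i, hi, h⟩
    · obtain ⟨t, -, ht⟩ := ((hind ∅ 0).and_eventually h).exists
      exact ht
    · have := neBot_towerFilter hind hdense i (V := V i) ((hV i hi).trans inf_le_left)
      exact Filter.empty_notMem _ h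
  obtain ⟨V, hV⟩ := exists_transfinite (T := Θ) (X := Ultrafilter I)
    (fun j V x => (x : Filter I) ≤ D ⊓ ⨅ i ∈ Set.Iio j, towerFilter D g i (V i))
    (fun j V V' x hVV' => by
      have : ⨅ i ∈ Set.Iio j, towerFilter D g i (V i) =
          ⨅ i ∈ Set.Iio j, towerFilter D g i (V' i) :=
        iInf_congr fun i => iInf_congr fun hi => by rw [hVV' i hi]
      rw [this]
      exact id)
    (fun j V hV => by
      have := hneBot V (Set.Iio j) hV
      exact ⟨Ultrafilter.of _, Ultrafilter.of_le _⟩)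
  have := hneBot V Set.univ fun j _ => hV j
  obtain ⟨U, hU⟩ := Ultrafilter.exists_le (D ⊓ ⨅ i ∈ Set.univ, towerFilter D g i (V i))
  have hUj : ∀ j, (U : Filter I) ≤ towerFilter D g j (V j) := fun j =>
    hU.trans (inf_le_right.trans (iInf₂_le j (Set.mem_univ j)))
  have hagree : ∀ j, ∀ A ∈ supportedSets D g (Set.Iio j), A ∈ U → A ∈ V j := by
    intro j A hA hAU
    by_contra hAV
    have hcompl : Aᶜ ∈ V j := Ultrafilter.compl_mem_iff_notMem.2 hAV
    exact Ultrafilter.compl_mem_iff_notMem.1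
      (hUj j (mem_towerFilter_of_mem_left (compl_mem_supportedSets hA) hcompl)) hAU
  have hle : ∀ j (f : I → ℕ), (∀ n, {t | n ≤ f t} ∈ supportedSets D g (Set.Iio j)) →
      (∀ n, ∀ᶠ t in (U : Filter I), n < f t) → ∀ᶠ t in (U : Filter I), g j t ≤ f t := by
    intro j f hf hfU
    exact hUj j (le_towerFilter hf fun n => hagree j _ (hf n) ((hfU n).mono fun t ht => ht.le))
  have hnonst : ∀ i n, ∀ᶠ t in (U : Filter I), n < g i t := fun i n =>
    hUj i (nonstandard_towerFilter i _ n)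
  refine ⟨U, hU.trans inf_le_left, hnonst, fun f hf => ?_, fun i j hij => ?_⟩
  · choose W hW hWf using fun n : ℕ => exists_countable_supportedSets hind hdense {t | n ≤ f t}
    obtain ⟨j, hj⟩ := hΘ (⋃ n, W n) (Set.countable_iUnion hW)
    exact ⟨j, hle j f (fun n => supportedSets_mono
      (fun i hi => hj i (Set.mem_iUnion.2 ⟨n, hi⟩)) (hWf n)) hf⟩
  · have h := hle j (fun t => g i t - 1)
      (fun n => mem_supportedSets_of_mem (Set.mem_Iio.2 hij) fun m => n ≤ m - 1)
      (fun n => (hnonst i (n + 1)).mono fun t ht => by omega)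
    filter_upwards [h, hnonst i 0] with t h1 h2
    omega

end Tower

/-! ### Realizing symmetric pre-cuts -/

section Realize

open Filter

theorem IsWeaklyCompactCard.exists_realize {κ : Cardinal.{u}} (hκ : IsWeaklyCompactCard κ)
    {I Θ : Type u} [Infinite Θ] (hΘ : #Θ < κ) (hI : κ ≤ #I) {D : Filter I} {g : Θ → I → ℕ}
    (hind : ∀ z y, ∃ᶠ t in D, t ∈ cylinder g z y)
    (hdense : ∀ A : Set I, (∃ᶠ t in D, t ∈ A) → ∃ z y, ∀ᶠ t in D, t ∈ cylinder g z y → t ∈ A)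
    (hgood : ∀ a b : I → I → ℕ, (∀ ε ζ, ∀ᶠ t in D, a ε t + 1 < b ζ t) →
      ∃ c : I → ℕ, ∀ ε, ∀ᶠ t in D, a ε t < c t ∧ c t < b ε t)
    {U : Filter I} (hUD : U ≤ D) {a b : κ.ord.ToType → I → ℕ}
    (ha : ∀ ε ε', ε < ε' → ∀ᶠ t in U, a ε t < a ε' t)
    (hb : ∀ ζ ζ', ζ < ζ' → ∀ᶠ t in U, b ζ' t < b ζ t)
    (hab : ∀ ε, ∀ᶠ t in U, a ε t < b ε t) :
    ∃ c : I → ℕ, ∀ ε, ∀ᶠ t in U, a ε t < c t ∧ c t < b ε t := by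
  classical
  have hinf : ℵ₀ ≤ κ := hκ.1.le
  have hK : #κ.ord.ToType = κ := Cardinal.mk_ord_toType κ
  let P := Finset (Θ × ℕ)
  have hP : #P < κ := by
    simp only [P, Cardinal.mk_finset_of_infinite, Cardinal.mk_prod, Cardinal.lift_uzero,
      Cardinal.mk_nat, Cardinal.lift_aleph0, Cardinal.mul_aleph0_eq (Cardinal.aleph0_le_mk Θ)]
    exact hΘ
  let box : P → Set I := fun p => {t | ∀ q ∈ p, g q.1 t = q.2}
  have hbox : ∀ z y, ∃ p : P, box p = cylinder g z y := fun z y =>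
    ⟨z.image fun i => (i, y i), by simp only [box, cylinder, Finset.forall_mem_image]⟩
  let H : κ.ord.ToType → κ.ord.ToType → Set I := fun ξ α =>
    {t | a ξ t < a α t ∧ a α t < b α t ∧ b α t < b ξ t}
  have hHU : ∀ ξ α, ξ < α → H ξ α ∈ U := fun ξ α hξα => by
    filter_upwards [ha ξ α hξα, hab α, hb ξ α hξα] with t h1 h2 h3 using ⟨h1, h2, h3⟩
  let s : κ.ord.ToType → κ.ord.ToType × P → Bool := fun α q =>
    decide (∀ᶠ t in D, t ∈ box q.2 → t ∈ H q.1 α)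
  obtain ⟨H₁, t₁, hH₁, ht₁⟩ := hκ.exists_eventually_const (Ξ := κ.ord.ToType × P) (by
    rw [Cardinal.mk_prod, Cardinal.lift_id, Cardinal.lift_id, hK]
    exact Cardinal.mul_le_of_le hinf le_rfl hP.le) s
  obtain ⟨H₂, t₂, hH₂, ht₂⟩ := hκ.exists_eventually_const (Ξ := P) hP.le fun ξ p => t₁ (ξ, p)
  choose β' hβ' using ht₂
  obtain ⟨β, hβ⟩ := hκ.exists_upper_bound (Set.range β') (Cardinal.mk_range_le.trans_lt hP)
  choose γ' hγ' using ht₁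
  have hγ : ∀ ξ, ∃ γ, ∀ p, γ' (ξ, p) < γ := fun ξ => by
    obtain ⟨γ, hγ⟩ := hκ.exists_upper_bound (Set.range fun p => γ' (ξ, p))
      (Cardinal.mk_range_le.trans_lt hP)
    exact ⟨γ, fun p => hγ _ (Set.mem_range_self p)⟩
  choose γ hγ using hγ
  have hcolor : ∀ ξ ∈ H₂, β ≤ ξ → ∀ α ∈ H₁, γ ξ ≤ α → ∀ p, s α (ξ, p) = t₂ p := by
    intro ξ hξ hβξ α hα hγα p
    rw [hγ' (ξ, p) α hα ((hγ ξ p).le.trans hγα)]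
    exact hβ' p ξ hξ ((hβ _ (Set.mem_range_self p)).le.trans hβξ)
  obtain ⟨ξ₀, hξ₀, hβξ₀⟩ := hH₂ β
  obtain ⟨α₀, hα₀, hγα₀⟩ := hH₁ (max (γ ξ₀) ξ₀)
  have hX₀U : H ξ₀ α₀ ∈ U := hHU ξ₀ α₀ ((le_max_right _ _).trans_lt hγα₀)
  have hsub : ∀ ξ ∈ H₂, β ≤ ξ → ∀ α ∈ H₁, γ ξ ≤ α →
      ∀ᶠ t in D, t ∈ H ξ₀ α₀ → t ∈ H ξ α := by
    intro ξ hξ hβξ α hα hγα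
    by_contra hne
    obtain ⟨z, y, hzy⟩ := hdense (H ξ₀ α₀ \ H ξ α) (by
      rw [Filter.not_eventually] at hne
      exact hne.mono fun t ht => by push Not at ht; exact ht)
    obtain ⟨p, hp⟩ := hbox z y
    have h₀ : s α₀ (ξ₀, p) = true := decide_eq_true (hzy.mono fun t ht h => (ht (hp ▸ h)).1)
    rw [hcolor ξ₀ hξ₀ hβξ₀.le α₀ hα₀ ((le_max_left _ _).trans hγα₀.le),
      ← hcolor ξ hξ hβξ α hα hγα] at h₀
    have h₁ : ∀ᶠ t in D, t ∈ box p → t ∈ H ξ α := of_decide_eq_true h₀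
    obtain ⟨t, ht, ht1, ht2⟩ := ((hind z y).and_eventually (hzy.and h₁)).exists
    exact (ht1 ht).2 (ht2 (hp ▸ ht))
  let H₃ : Set κ.ord.ToType := {ξ | ξ ∈ H₂ ∧ β ≤ ξ}
  have hlt : ∀ ε ∈ H₃, ∀ ζ ∈ H₃, ∀ᶠ t in D, t ∈ H ξ₀ α₀ → a ε t + 1 < b ζ t := by
    intro ε hε ζ hζ
    obtain ⟨α, hα, hγα⟩ := hH₁ (max (γ ε) (γ ζ))
    filter_upwards [hsub ε hε.1 hε.2 α hα ((le_max_left _ _).trans hγα.le),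
      hsub ζ hζ.1 hζ.2 α hα ((le_max_right _ _).trans hγα.le)] with t h1 h2 ht
    have h3 := h1 ht
    have h4 := h2 ht
    simp only [H, mem_ofPred_eq] at h3 h4
    omega
  have hne : Nonempty H₃ := ⟨⟨ξ₀, hξ₀, hβξ₀.le⟩⟩
  obtain ⟨emb⟩ : Nonempty (H₃ ↪ I) := by
    rw [← Cardinal.le_def]
    exact (Cardinal.mk_set_le H₃).trans (hK.le.trans hI)
  let e : I → H₃ := Function.invFun emb
  have he : Function.Surjective e := Function.invFun_surjective emb.injective
  obtain ⟨c, hc⟩ := hgood (fun i t => if t ∈ H ξ₀ α₀ then a (e i) t else 0)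
    (fun i t => if t ∈ H ξ₀ α₀ then b (e i) t else 2) (fun i j => by
      filter_upwards [hlt (e i) (e i).2 (e j) (e j).2] with t ht
      by_cases h : t ∈ H ξ₀ α₀
      · simpa [h] using ht h
      · simp [h])
  refine ⟨c, fun ε => ?_⟩
  obtain ⟨ξ, hξ, hεξ⟩ := hH₂ (max ε β)
  obtain ⟨i, hi⟩ := he ⟨ξ, hξ, (le_max_right _ _).trans hεξ.le⟩
  have hlt' : ε < ξ := (le_max_left _ _).trans_lt hεξ
  filter_upwards [hUD (hc i), hX₀U, ha ε ξ hlt', hb ε ξ hlt'] with t h1 h2 h3 h4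
  simp only [if_pos h2, hi] at h1
  exact ⟨h3.trans h1.1, h1.2.trans h4⟩

end Realize

/-! ### Coinitiality and regularity -/

theorem exists_upper_bound_of_isRegular {θ : Cardinal.{u}} (h : θ.IsRegular) (W : Set θ.ord.ToType)
    (hW : #W < θ) : ∃ j, ∀ i ∈ W, i < j := by
  by_contra! hne
  refine (h.le_cof_ord.trans ?_).not_gt hW
  rw [← Ordinal.cof_toType]
  exact Order.cof_le fun j => hne j

theorem lcfAleph0_eq {I : Type u} {θ : Cardinal.{u}} (hθ : θ.IsRegular) {D : Filter I} [D.NeBot]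
    {g : θ.ord.ToType → I → ℕ} (hg : ∀ i n, ∀ᶠ t in D, n < g i t)
    (hcoinit : ∀ f : I → ℕ, (∀ n, ∀ᶠ t in D, n < f t) → ∃ j, ∀ᶠ t in D, g j t ≤ f t)
    (hanti : ∀ i j, i < j → ∀ᶠ t in D, g j t < g i t) : lcfAleph0 D = θ := by
  have hmem : #(Set.range g) ∈ {c : Cardinal.{u} | ∃ S : Set (I → ℕ), #S = c ∧
      (∀ f ∈ S, IsNonstandard D f) ∧ ∀ h : I → ℕ, IsNonstandard D h → ∃ f ∈ S, leD D f h} := by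
    refine ⟨Set.range g, rfl, ?_, fun h hh => ?_⟩
    · rintro _ ⟨i, rfl⟩
      exact hg i
    · obtain ⟨j, hj⟩ := hcoinit h hh
      exact ⟨g j, Set.mem_range_self j, hj⟩
  refine le_antisymm ((csInf_le' hmem).trans ?_) (le_csInf ⟨_, hmem⟩ ?_)
  · exact Cardinal.mk_range_le.trans (Cardinal.mk_ord_toType θ).le
  · rintro _ ⟨S, rfl, hS, hcoS⟩
    by_contra! hlt
    choose i hi using fun f : S => hcoinit f (hS f f.2)
    obtain ⟨j, hj⟩ := exists_upper_bound_of_isRegular hθ (Set.range i)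
      (Cardinal.mk_range_le.trans_lt hlt)
    obtain ⟨f, hf, hfj⟩ := hcoS (g j) (hg j)
    have hfj' : ∀ᶠ t in D, f t ≤ g j t := hfj
    obtain ⟨t, h1, h2, h3⟩ := ((hi ⟨f, hf⟩).and ((hanti _ j (hj _ (Set.mem_range_self ⟨f, hf⟩))).and
      hfj')).exists
    exact absurd (h1.trans h3) h2.not_ge

theorem isRegularFilter_of_index {I : Type u} {D : Filter I} {X : I → Set I} (hX : ∀ j, X j ∈ D)
    (hfin : ∀ t, {j | t ∈ X j}.Finite) : IsRegularFilter #I D := by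
  classical
  obtain ⟨σ⟩ : Nonempty ((#I).ord.ToType ≃ I) := by
    rw [← Cardinal.eq, Cardinal.mk_ord_toType]
  refine ⟨fun i => if h : i < (#I).ord then X (σ (Ordinal.ToType.mk ⟨i, h⟩)) else ∅,
    fun i hi => ?_, fun t => ?_⟩
  · simp only [dif_pos hi]
    exact hX _
  · refine ((hfin t).image fun j => (Ordinal.ToType.mk.symm (σ.symm j)).1).subset ?_
    rintro i ⟨hi, hti⟩
    simp only [dif_pos hi] at hti
    exact ⟨_, hti, by simp⟩

/-- for `kappa` weakly compact and `ℵ₀ < theta = cf(theta) < kappa ≤ lam`,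
there is a `lam`-regular ultrafilter `D` on a set of cardinality `lam` with
`lcf(ℵ₀, D) = theta` in which every `(kappa, kappa)`-pre-cut is realized. -/
theorem weakly_compact_symmetric_cuts {I : Type u} (kappa theta lam : Cardinal.{u})
    (hwc : IsWeaklyCompactCard kappa)
    (ht0 : ℵ₀ < theta) (htreg : theta.IsRegular)
    (htk : theta < kappa) (hkl : kappa ≤ lam) (hI : #I = lam) :
    ∃ D : Ultrafilter I,
      IsRegularFilter lam (D : Filter I) ∧
      lcfAleph0 (D : Filter I) = theta ∧
      ∀ a₁ a₂ : Ordinal.{u} → I → ℕ,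
        (∀ ε ε' : Ordinal.{u}, ε < ε' → ε' < kappa.ord →
          ltD (D : Filter I) (a₁ ε) (a₁ ε')) →
        (∀ ζ ζ' : Ordinal.{u}, ζ < ζ' → ζ' < kappa.ord →
          ltD (D : Filter I) (a₂ ζ') (a₂ ζ)) →
        (∀ ε ζ : Ordinal.{u}, ε < kappa.ord → ζ < kappa.ord →
          ltD (D : Filter I) (a₁ ε) (a₂ ζ)) →
        ∃ b : I → ℕ,
          (∀ ε, ε < kappa.ord → ltD (D : Filter I) (a₁ ε) b) ∧
          ∀ ζ, ζ < kappa.ord → ltD (D : Filter I) b (a₂ ζ) := by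

  subst hI
  have hinf : ℵ₀ < #I := ht0.trans (htk.trans_le hkl)
  have : Infinite I := Cardinal.infinite_iff.2 hinf.le
  have : Infinite theta.ord.ToType := by
    rw [Cardinal.infinite_iff, Cardinal.mk_ord_toType]
    exact ht0.le
  obtain ⟨D, g, X, hX, hfin, hind, hdense, hgood⟩ := exists_base_filter I theta.ord.ToType (by
    rw [Cardinal.mk_ord_toType]
    exact (htk.le.trans hkl).trans (Cardinal.cantor _).le)
  obtain ⟨U, hUD, hg, hcoinit, hanti⟩ := exists_ultrafilter_coinitial
    (fun W hW => exists_upper_bound_of_isRegular htreg W (hW.le_aleph0.trans_lt ht0)) hind hdense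
  refine ⟨U, isRegularFilter_of_index (fun j => hUD (hX j)) hfin,
    lcfAleph0_eq htreg hg hcoinit hanti, fun a₁ a₂ h₁ h₂ h₁₂ => ?_⟩
  let e := Ordinal.ToType.mk (o := kappa.ord)
  obtain ⟨c, hc⟩ := hwc.exists_realize (by rw [Cardinal.mk_ord_toType]; exact htk) hkl hind hdense
    hgood hUD (a := fun ξ => a₁ (e.symm ξ)) (b := fun ξ => a₂ (e.symm ξ))
    (fun ε ε' hε => h₁ _ _ (e.symm.strictMono hε) (e.symm ε').2)
    (fun ζ ζ' hζ => h₂ _ _ (e.symm.strictMono hζ) (e.symm ζ').2)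
    (fun ε => h₁₂ _ _ (e.symm ε).2 (e.symm ε).2)
  have hval : ∀ (ε : Ordinal.{u}) (hε : ε < kappa.ord), (e.symm (e ⟨ε, hε⟩)).1 = ε := by simp
  refine ⟨c, fun ε hε => ?_, fun ζ hζ => ?_⟩
  · refine Filter.Eventually.mono (hc (e ⟨ε, hε⟩)) fun t ht => ?_
    have := ht.1
    rwa [hval] at this
  · refine Filter.Eventually.mono (hc (e ⟨ζ, hζ⟩)) fun t ht => ?_
    have := ht.2
    rwa [hval] at this
end
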